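/- arXiv:2312.08742 — 6 statements merged into one kernel-verified Lean document; each statement's English description precedes it below -/
import Mathlib

section
/- Let d ≥ 4 and let f = x^d + a_1 x^{d-1} + ⋯ + a_{d-1} x be the generic monic polynomial of degree d with zero constant term, viewed as a polynomial in x over the ring ℂ[a_1, …, a_{d-1}] of multivariate polynomials in the indeterminates a_1, …, a_{d-1}. For each i ∈ {1, …, d-1} let R_i ∈ ℂ[a_1, …, a_{d-1}] be the resultant (with respect to x) of f and its i-th Hasse derivative H_i(f). Then for every i ∈ {d-3, d-2, d-1}, the element R_i does not belong to the radical of the ideal of ℂ[a_1, …, a_{d-1}] generated by the d-2 elements R_1, …, R_{i-1}, R_{i+1}, …, R_{d-1}. -/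
open Polynomial

/-- The Sylvester matrix of two polynomials `p` and `q`, regarded as having degrees
`m` and `n` respectively: an `(n + m) × (n + m)` matrix whose first `n` rows carry
the coefficients of `p` and whose last `m` rows carry the coefficients of `q`. -/
noncomputable def sylvesterMatrix {R : Type*} [CommRing R] (m n : ℕ) (p q : R[X]) :
    Matrix (Fin (n + m)) (Fin (n + m)) R :=
  Matrix.of fun i j =>
    if (i : ℕ) < n then
      (if (i : ℕ) ≤ (j : ℕ) ∧ (j : ℕ) ≤ (i : ℕ) + m then p.coeff (m + i - j) else 0)
    else
      (if (i : ℕ) - n ≤ (j : ℕ) ∧ (j : ℕ) ≤ (i : ℕ) then q.coeff (n + ((i : ℕ) - n) - j) else 0)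

/-- The resultant of `p` and `q` (of degrees `m` and `n`), as the determinant of the
Sylvester matrix. -/
noncomputable def resultant {R : Type*} [CommRing R] (m n : ℕ) (p q : R[X]) : R :=
  (sylvesterMatrix m n p q).det

/-- The generic monic polynomial `f = x^d + a_1 x^(d-1) + ⋯ + a_(d-1) x` of degree `d`
with zero constant term, over `ℂ[a_1, …, a_(d-1)]`; the variable `a_(j+1)` is indexed
by `j : Fin (d-1)`. -/
noncomputable def genericCA (d : ℕ) : Polynomial (MvPolynomial (Fin (d - 1)) ℂ) :=
  X ^ d + ∑ j : Fin (d - 1), C (MvPolynomial.X j) * X ^ (d - 1 - (j : ℕ))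

/-- `caRes d i` is `R_i`, the resultant of `f` and its `i`-th Hasse derivative `H_i(f)`,
where `f` is the generic monic degree-`d` polynomial with zero constant term. -/
noncomputable def caRes (d i : ℕ) : MvPolynomial (Fin (d - 1)) ℂ :=
  resultant d (d - i) (genericCA d) (Polynomial.hasseDeriv i (genericCA d))

lemma caAux_map {R S : Type*} [CommRing R] [CommRing S] (φ : R →+* S) (m n : ℕ) (p q : R[X]) :
    φ (_root_.resultant m n p q) = _root_.resultant m n (p.map φ) (q.map φ) := by
  unfold _root_.resultant
  rw [RingHom.map_det]
  congr 1
  ext a b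
  simp only [sylvesterMatrix, RingHom.mapMatrix_apply, Matrix.map_apply, Matrix.of_apply,
    Polynomial.coeff_map]
  split_ifs <;> simp

lemma caAux_zero {R : Type*} [CommRing R] (m n : ℕ) (hm : 0 < m) (p q : R[X])
    (hp : p.coeff 0 = 0) (hq : q.coeff 0 = 0) : _root_.resultant m n p q = 0 := by
  unfold _root_.resultant
  apply Matrix.det_eq_zero_of_column_eq_zero (⟨n + m - 1, by omega⟩ : Fin (n + m))
  intro a
  have ha := a.2
  simp only [sylvesterMatrix, Matrix.of_apply]
  split_ifs with h1 h2 h3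
  · rw [show m + (a : ℕ) - (n + m - 1) = 0 by omega, hp]
  · rfl
  · rw [show n + ((a : ℕ) - n) - (n + m - 1) = 0 by omega, hq]
  · rfl

lemma caAux_ne (d i : ℕ) (hi : 1 ≤ i) (hid : i < d) (c : ℂ) (hc : c ≠ 1) (p q : ℂ[X])
    (hp : ∀ k, p.coeff k = (if k = d then 1 else 0) + (if k = i then 1 else 0))
    (hq : ∀ k, q.coeff k = (if k = d - i then c else 0) + (if k = 0 then 1 else 0)) :
    _root_.resultant d (d - i) p q ≠ 0 := by
  unfold _root_.resultant
  intro h0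
  obtain ⟨v, hv0, hv⟩ := Matrix.exists_mulVec_eq_zero_iff.2 h0
  apply hv0
  obtain ⟨n, hn⟩ : ∃ n, n = d - i := ⟨_, rfl⟩
  rw [← hn] at hq
  have h1 : ∀ r, (hr : r < n) → v ⟨r, by omega⟩ + v ⟨r + n, by omega⟩ = 0 := by
    intro r hr
    have := congrFun hv ⟨r, by omega⟩
    simp only [Matrix.mulVec, dotProduct, Pi.zero_apply] at this
    rw [← this, ← Fintype.sum_ite_eq (⟨r, by omega⟩ : Fin (d - i + d)) v,
      ← Fintype.sum_ite_eq (⟨r + n, by omega⟩ : Fin (d - i + d)) v, ← Finset.sum_add_distrib]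
    refine Finset.sum_congr rfl fun j _ => ?_
    have hj := j.2
    simp only [sylvesterMatrix, Matrix.of_apply, hp, Fin.ext_iff]
    split_ifs <;> first | omega | simp
  have h2 : ∀ k, (hk : k < d) → c * v ⟨k, by omega⟩ + v ⟨k + n, by omega⟩ = 0 := by
    intro k hk
    have := congrFun hv ⟨n + k, by omega⟩
    simp only [Matrix.mulVec, dotProduct, Pi.zero_apply] at this
    rw [← this, ← Fintype.sum_ite_eq (⟨k, by omega⟩ : Fin (d - i + d)) v,
      ← Fintype.sum_ite_eq (⟨k + n, by omega⟩ : Fin (d - i + d)) v, Finset.mul_sum,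
      ← Finset.sum_add_distrib]
    refine Finset.sum_congr rfl fun j _ => ?_
    have hj := j.2
    simp only [sylvesterMatrix, Matrix.of_apply, hq, Fin.ext_iff]
    split_ifs <;> first | omega | simp
  have key : ∀ k, (hk : k < d - i + d) → v ⟨k, hk⟩ = 0 := by
    intro k
    induction k using Nat.strong_induction_on with
    | _ k ih =>
      intro hk
      by_cases hkn : k < n
      · have e1 := h1 k hkn
        have e2 := h2 k (by omega)
        have : (c - 1) * v ⟨k, hk⟩ = 0 := by linear_combination e2 - e1
        exact (mul_eq_zero.1 this).resolve_left (sub_ne_zero.2 hc)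
      · have e2 := h2 (k - n) (by omega)
        rw [ih (k - n) (by omega), mul_zero, zero_add] at e2
        convert e2 using 3
        omega
  funext k
  exact key k k.2

theorem caRes_not_mem_radical_span_others (d : ℕ) (hd : 4 ≤ d)
    (i : ℕ) (hi : i ∈ ({d - 3, d - 2, d - 1} : Set ℕ)) :
    caRes d i ∉
      (Ideal.span (caRes d '' (Set.Icc 1 (d - 1) \ {i}))).radical := by
  have hi' : 1 ≤ i ∧ i < d := by
    simp only [Set.mem_insert_iff, Set.mem_singleton_iff] at hi
    omega
  obtain ⟨hi1, hid⟩ := hi'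
  clear hi
  let φ : MvPolynomial (Fin (d - 1)) ℂ →+* ℂ :=
    MvPolynomial.eval (fun k => if d - 1 - (k : ℕ) = i then 1 else 0)
  have hg : (genericCA d).map φ = X ^ d + X ^ i := by
    simp only [genericCA, Polynomial.map_add, Polynomial.map_pow, Polynomial.map_X,
      Polynomial.map_sum, Polynomial.map_mul, Polynomial.map_C]
    congr 1
    rw [Finset.sum_eq_single (⟨d - 1 - i, by omega⟩ : Fin (d - 1))]
    · have e : d - 1 - (d - 1 - i) = i := by omega
      simp [φ, e]
    · intro b _ hb
      have hb2 := b.2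
      have e : ¬ (d - 1 - (b : ℕ) = i) := by
        intro h
        apply hb
        ext
        simp only
        omega
      simp [φ, e]
    · simp
  have hH : ∀ j, (hasseDeriv j (genericCA d)).map φ = hasseDeriv j (X ^ d + X ^ i) := by
    intro j
    rw [← hg]
    ext k
    simp [hasseDeriv_coeff]
  have hcoef : ∀ k, (X ^ d + X ^ i : ℂ[X]).coeff k
      = (if k = d then 1 else 0) + (if k = i then 1 else 0) := by
    intro k
    simp [Polynomial.coeff_X_pow]
  have hle : (Ideal.span (caRes d '' (Set.Icc 1 (d - 1) \ {i}))).radical ≤ RingHom.ker φ := by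
    rw [(RingHom.ker_isPrime φ).radical_le_iff, Ideal.span_le]
    rintro _ ⟨j, ⟨⟨hj1, hj2⟩, hji⟩, rfl⟩
    simp only [Set.mem_singleton_iff] at hji
    simp only [SetLike.mem_coe, RingHom.mem_ker]
    unfold caRes
    rw [caAux_map, hg, hH]
    apply caAux_zero _ _ (by omega)
    · rw [hcoef, if_neg (by omega), if_neg (by omega), add_zero]
    · rw [hasseDeriv_coeff, hcoef, if_neg (by omega), if_neg (by omega)]
      simp
  intro hmem
  have := hle hmem
  rw [RingHom.mem_ker] at this
  unfold caRes at this
  rw [caAux_map, hg, hH] at this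
  refine caAux_ne d i hi1 hid (d.choose i : ℂ) ?_ _ _ hcoef ?_ this
  · intro h
    have h' : d.choose i = 1 := by exact_mod_cast h
    rw [Nat.choose_eq_one_iff] at h'
    omega
  · intro k
    rw [hasseDeriv_coeff, hcoef]
    by_cases h1 : k = d - i
    · have : k + i = d := by omega
      rw [if_pos this, if_neg (by omega), if_pos h1, if_neg (by omega), this]
      simp
    · rw [if_neg (by omega : ¬ k + i = d), if_neg h1]
      by_cases h2 : k = 0
      · subst h2
        simp
      · rw [if_neg (by omega), if_neg h2]
        simp
end

section
/- Let f ∈ ℝ[x] be a polynomial of degree d ≥ 1 all of whose roots are real, with roots β_1 ≤ β_2 ≤ ⋯ ≤ β_d listed in increasing order counted with multiplicity. Then the derivative f' has d-1 real roots γ_1 ≤ γ_2 ≤ ⋯ ≤ γ_{d-1}, counted with multiplicity (i.e., all roots of f' are real), and for each i ∈ {1, …, d-1}: if β_i < β_{i+1} then γ_i lies in the open interval (β_i, β_{i+1}), while if β_i = β_{i+1} then γ_i = β_i. -/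
open Polynomial

theorem rolle_interlacing_roots (f : Polynomial ℝ) (d : ℕ) (hd : 1 ≤ d)
    (hdeg : f.natDegree = d)
    (β : ℕ → ℝ)
    (hβmono : ∀ i j : ℕ, i ≤ j → j < d → β i ≤ β j)
    (hβroots : f.roots = (Multiset.range d).map β) :
    ∃ γ : ℕ → ℝ,
      (∀ i j : ℕ, i ≤ j → j < d - 1 → γ i ≤ γ j) ∧
      (derivative f).roots = (Multiset.range (d - 1)).map γ ∧
      ∀ i : ℕ, i + 1 < d →
        (β i < β (i + 1) → γ i ∈ Set.Ioo (β i) (β (i + 1))) ∧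
        (β i = β (i + 1) → γ i = β i) := by
  classical
  have hf : f ≠ 0 := by
    rintro rfl
    simp at hdeg
    omega
  have hf' : derivative f ≠ 0 := by
    intro h
    have := natDegree_eq_zero_of_derivative_eq_zero h
    omega
  have hroot : ∀ j, j < d → f.eval (β j) = 0 := by
    intro j hj
    have : β j ∈ f.roots := by
      rw [hβroots]
      exact Multiset.mem_map_of_mem _ (Multiset.mem_range.2 hj)
    exact (mem_roots hf).1 this
  have hex : ∀ i : ℕ, ∃ c : ℝ, i + 1 < d →
      ((β i < c ∧ c < β (i + 1)) ∧ (derivative f).eval c = 0) ∨ (β i = β (i + 1) ∧ c = β i) := by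
    intro i
    by_cases hi : i + 1 < d
    · rcases (hβmono i (i + 1) (by omega) hi).lt_or_eq with h | h
      · obtain ⟨z, hz1, hz2⟩ := exists_deriv_eq_zero h f.continuousOn
          ((hroot i (by omega)).trans (hroot (i + 1) hi).symm)
        refine ⟨z, fun _ => Or.inl ⟨hz1, ?_⟩⟩
        rwa [← f.deriv]
      · exact ⟨β i, fun _ => Or.inr ⟨h, rfl⟩⟩
    · exact ⟨0, fun h => absurd h hi⟩
  choose γ hγ using hex
  have hlo : ∀ i, i + 1 < d → β i ≤ γ i := by
    intro i hi
    rcases hγ i hi with h | h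
    · exact h.1.1.le
    · exact h.2.ge
  have hhi : ∀ i, i + 1 < d → γ i ≤ β (i + 1) := by
    intro i hi
    rcases hγ i hi with h | h
    · exact h.1.2.le
    · exact (h.2.trans h.1).le
  refine ⟨γ, ?_, ?_, ?_⟩
  · intro i j hij hj
    rcases hij.eq_or_lt with rfl | hlt
    · exact le_rfl
    · exact (hhi i (by omega)).trans ((hβmono (i + 1) j hlt (by omega)).trans (hlo j (by omega)))
  · symm
    apply Multiset.eq_of_le_of_card_le
    · rw [Multiset.le_iff_count]
      intro x
      have hcount : ∀ (n : ℕ) (g : ℕ → ℝ), Multiset.count x ((Multiset.range n).map g)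
          = ((Finset.range n).filter (fun i => x = g i)).card := by
        intro n g
        rw [Multiset.count_map]
        rfl
      rw [hcount, count_roots]
      by_cases hx : ∃ j, j < d ∧ x = β j
      · have h1 := rootMultiplicity_sub_one_le_derivative_rootMultiplicity f x
        refine le_trans ?_ h1
        rw [← count_roots, hβroots, hcount]
        have hmin := Nat.find_spec hx
        have hmin' := fun m => Nat.find_min' hx (m := m)
        set j0 := Nat.find hx
        rw [← Finset.card_erase_of_mem (a := j0) (by simpa using hmin)]
        apply Finset.card_le_card_of_injOn (fun i => i + 1)
        · intro i hi
          simp only [Finset.coe_filter, Finset.mem_range, Set.mem_setOf_eq] at hi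
          obtain ⟨hi, hxi⟩ := hi
          have key : x = β i ∧ x = β (i + 1) := by
            rcases hγ i (by omega) with h | h
            · exfalso
              obtain ⟨j, hj, hxj⟩ := hx
              rcases Nat.lt_or_ge i j with hij | hij
              · have := hβmono (i + 1) j hij hj
                linarith [h.1.2]
              · have := hβmono j i hij (by omega)
                linarith [h.1.1]
            · exact ⟨by linarith [h.2], by linarith [h.1, h.2]⟩
          have := hmin' i ⟨by omega, key.1⟩
          simp only [Finset.coe_erase, Finset.coe_filter, Finset.mem_range, Set.mem_diff,
            Set.mem_setOf_eq, Set.mem_singleton_iff]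
          exact ⟨⟨by omega, key.2⟩, by omega⟩
        · intro a _ b _ h
          simpa using h
      · have hs : ∀ i, i + 1 < d → x = γ i →
            (β i < x ∧ x < β (i + 1)) ∧ (derivative f).eval x = 0 := by
          intro i hi hxi
          rcases hγ i hi with h | h
          · rw [hxi]; exact h
          · exact absurd ⟨i, by omega, hxi.trans h.2⟩ hx
        rcases Finset.eq_empty_or_nonempty
          ((Finset.range (d - 1)).filter (fun i => x = γ i)) with he | ⟨i, hi⟩
        · rw [he]; simp
        · have h1 : 0 < rootMultiplicity x (derivative f) := by
            rw [rootMultiplicity_pos hf']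
            simp only [Finset.mem_filter, Finset.mem_range] at hi
            exact (hs i (by omega) hi.2).2
          refine le_trans ?_ h1
          rw [Nat.succ_eq_add_one, zero_add, Finset.card_le_one]
          have hlt : ∀ a b, b < d - 1 → x = γ a → x = γ b → ¬ a < b := by
            intro a b hb ha' hb' hab
            have h2 := (hs a (by omega) ha').1.2
            have h3 := (hs b (by omega) hb').1.1
            have := hβmono (a + 1) b hab (by omega)
            linarith
          intro a ha b hb
          simp only [Finset.mem_filter, Finset.mem_range] at ha hb
          have := hlt a b hb.1 ha.2 hb.2
          have := hlt b a ha.1 hb.2 ha.2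
          omega
    · rw [Multiset.card_map, Multiset.card_range, ← hdeg]
      exact (card_roots' _).trans (natDegree_derivative_le f)
  · intro i hi
    rcases hγ i hi with h | h
    · exact ⟨fun _ => h.1, fun h' => by linarith [h.1.1, h.1.2]⟩
    · exact ⟨fun h' => absurd h.1 h'.ne, fun _ => h.2⟩
end

section
/- Fix d ≥ 2 and fix d-2 pairs of integers (k_1, m_1), …, (k_{d-2}, m_{d-2}) with 1 ≤ k_1 < k_2 < ⋯ < k_{d-2} ≤ d-1 and 1 ≤ m_j ≤ d - k_j for each j. Then there exists a monic polynomial f ∈ ℝ[x] of degree d such that f(0) = 0, f(1) = 0, all roots of f are real and lie in the closed interval [0,1], and for every j ∈ {1, …, d-2}, the m_j-th smallest root (counted with multiplicity) of the Hasse derivative H_{k_j}(f) is a root of f. -/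
open Polynomial

/-- The `m`-th smallest root (counted with multiplicity, `1`-indexed) of a real
polynomial `g`: the `(m-1)`-st entry of the multiset of real roots of `g` sorted in
weakly increasing order (with junk value `0` out of range). -/
noncomputable def nthSmallestRoot (g : Polynomial ℝ) (m : ℕ) : ℝ :=
  (g.roots.sort (· ≤ ·)).getD (m - 1) 0

theorem rolle_filter (p : ℝ[X]) (P : ℝ → Prop) [DecidablePred P]
    (hP : ∀ x y z, P x → P y → x < z → z < y → P z) :
    p.roots.countP P ≤ p.derivative.roots.countP P + 1 := by
  classical
  rcases eq_or_ne (derivative p) 0 with hp' | hp'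
  · rw [eq_C_of_derivative_eq_zero hp']
    simp
  have hp : p ≠ 0 := ne_of_apply_ne derivative (by rwa [derivative_zero])
  set A := p.roots.filter P with hA
  set B := p.derivative.roots.filter P with hB
  have h1 : A.toFinset.card ≤ (B.toFinset \ A.toFinset).card + 1 := by
    refine Finset.card_le_sdiff_of_interleaved fun x hx y hy hxy hxy' => ?_
    rw [Multiset.mem_toFinset, hA, Multiset.mem_filter, mem_roots hp] at hx hy
    obtain ⟨z, hz1, hz2⟩ := exists_deriv_eq_zero hxy p.continuousOn (hx.1.trans hy.1.symm)
    refine ⟨z, ?_, hz1⟩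
    rw [Multiset.mem_toFinset, hB, Multiset.mem_filter, mem_roots hp', IsRoot, ← p.deriv]
    exact ⟨hz2, hP x y z hx.2 hy.2 hz1.1 hz1.2⟩
  have h2 : ∀ x ∈ A.toFinset, A.count x ≤ B.count x + 1 := by
    intro x hx
    rw [Multiset.mem_toFinset, hA, Multiset.mem_filter] at hx
    rw [hA, hB, Multiset.count_filter_of_pos hx.2, Multiset.count_filter_of_pos hx.2,
      count_roots, count_roots]
    have := rootMultiplicity_sub_one_le_derivative_rootMultiplicity p x
    omega
  rw [Multiset.countP_eq_card_filter, Multiset.countP_eq_card_filter, ← hA, ← hB]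
  have h3 : A.card ≤ ∑ x ∈ A.toFinset, B.count x + A.toFinset.card := by
    rw [← Multiset.toFinset_sum_count_eq, Finset.card_eq_sum_ones, ← Finset.sum_add_distrib]
    exact Finset.sum_le_sum h2
  have h4 : (B.toFinset \ A.toFinset).card ≤ ∑ x ∈ B.toFinset \ A.toFinset, B.count x := by
    rw [Finset.card_eq_sum_ones]
    refine Finset.sum_le_sum fun x hx => ?_
    rw [Nat.succ_le_iff, Multiset.count_pos, ← Multiset.mem_toFinset]
    exact (Finset.mem_sdiff.1 hx).1
  have h5 : ∑ x ∈ A.toFinset, B.count x + ∑ x ∈ B.toFinset \ A.toFinset, B.count x = B.card := by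
    rw [← Finset.sum_union Finset.disjoint_sdiff, Finset.union_sdiff_self_eq_union, ←
        Multiset.toFinset_sum_count_eq, ← Finset.sum_subset Finset.subset_union_right]
    intro x _ hx₂
    simpa only [Multiset.mem_toFinset, Multiset.count_eq_zero] using hx₂
  omega

theorem sign_prod (s : Multiset ℝ) (t : ℝ) (ht : t ∉ s) :
    0 < (-1 : ℝ) ^ (s.countP (t < ·)) * (s.map (fun a => t - a)).prod := by
  induction s using Multiset.induction_on with
  | empty => simp
  | cons a s ih =>
    simp only [Multiset.mem_cons, not_or] at ht
    have := ih ht.2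
    rw [Multiset.countP_cons, Multiset.map_cons, Multiset.prod_cons]
    rcases lt_or_gt_of_ne ht.1 with h | h
    · rw [if_pos h, pow_succ]
      nlinarith [mul_pos this (sub_pos.2 h)]
    · rw [if_neg (not_lt.2 h.le), add_zero]
      nlinarith [mul_pos this (sub_pos.2 h)]

theorem count_facts (p : ℝ[X]) (hp : p.roots.card = p.natDegree) (hn : 1 ≤ p.natDegree) :
    p.derivative.roots.card = p.natDegree - 1 ∧ p.derivative.natDegree = p.natDegree - 1 ∧
    ∀ t : ℝ, p.roots.countP (t < ·) ≤ p.derivative.roots.countP (t < ·) + 1 ∧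
      p.derivative.roots.countP (t < ·) ≤ p.roots.countP (t < ·) := by
  have h0 : p.derivative.natDegree = p.natDegree - 1 := natDegree_derivative _
  have h1 := card_roots_le_derivative p
  have h2 := card_roots' p.derivative
  refine ⟨by omega, h0, fun t => ?_⟩
  have h3 := rolle_filter p (t < ·) (fun x y z hx hy h1 h2 => hx.trans h1)
  have h4 := rolle_filter p (fun x => ¬ t < x)
    (fun x y z hx hy h1 h2 => not_lt.2 (h2.le.trans (not_lt.1 hy)))
  have h5 := Multiset.card_eq_countP_add_countP (t < ·) p.roots
  have h6 := Multiset.card_eq_countP_add_countP (t < ·) p.derivative.roots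
  refine ⟨h3, ?_⟩
  omega

theorem parity (p : ℝ[X]) (hp : p.roots.card = p.natDegree) (hn : 1 ≤ p.natDegree) (t : ℝ)
    (h1 : p.eval t ≠ 0) (h2 : p.derivative.eval t ≠ 0) :
    0 < (-1 : ℝ) ^ (p.roots.countP (t < ·) + p.derivative.roots.countP (t < ·)) *
      (p.roots.map (fun a => 1 / (t - a))).sum := by
  obtain ⟨c1, c2, -⟩ := count_facts p hp hn
  have sp : p.Splits := splits_iff_card_roots.2 hp
  have sp' : p.derivative.Splits := splits_iff_card_roots.2 (c1.trans c2.symm)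
  have hp0 : p ≠ 0 := by rintro rfl; simp at h1
  have hp0' : p.derivative ≠ 0 := by intro h; simp [h] at h2
  have e := sp.eval_derivative_div_eval_of_ne_zero h1
  rw [← e]
  have s1 := sign_prod p.roots t (by rw [mem_roots hp0]; exact h1)
  have s2 := sign_prod p.derivative.roots t (by rw [mem_roots hp0']; exact h2)
  rw [sp.eval_eq_prod_roots, sp'.eval_eq_prod_roots, leadingCoeff_derivative]
  have hl : p.leadingCoeff ≠ 0 := leadingCoeff_ne_zero.2 hp0
  have hn' : (0:ℝ) < p.natDegree := by exact_mod_cast hn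
  set u := (p.roots.map (fun a => t - a)).prod
  set v := (p.derivative.roots.map (fun a => t - a)).prod
  have hu : u ≠ 0 := by rintro h; rw [h] at s1; simp at s1
  have : (-1 : ℝ) ^ (p.roots.countP (t < ·) + p.derivative.roots.countP (t < ·)) *
      (p.leadingCoeff * p.natDegree * v / (p.leadingCoeff * u)) =
      ((-1 : ℝ) ^ (p.roots.countP (t < ·)) * u) * ((-1 : ℝ) ^ (p.derivative.roots.countP (t < ·)) * v)
       * p.natDegree / u ^ 2 := by
    field_simp
    ring
  have h : 0 < ((-1 : ℝ) ^ (p.roots.countP (t < ·)) * u) * ((-1 : ℝ) ^ (p.derivative.roots.countP (t < ·)) * v)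
       * p.natDegree / u ^ 2 := by positivity
  rw [← this] at h
  convert h using 3

theorem sorted_le (s t : Multiset ℝ) (F : Set ℝ) (hF : F.Finite) (hc : s.card = t.card)
    (h : ∀ x, x ∉ F → s.countP (x < ·) ≤ t.countP (x < ·)) (i : ℕ)
    (hi : i < (s.sort (· ≤ ·)).length) (hi' : i < (t.sort (· ≤ ·)).length) :
    (s.sort (· ≤ ·))[i] ≤ (t.sort (· ≤ ·))[i] := by
  by_contra! hlt
  obtain ⟨x, hx, hxF⟩ := (Set.Ioo_infinite hlt).exists_notMem_finite hF
  have h := h x hxF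
  have ps := Multiset.pairwise_sort s (· ≤ ·)
  have pt := Multiset.pairwise_sort t (· ≤ ·)
  have ls := Multiset.length_sort (s := s) (r := (· ≤ ·))
  have lt := Multiset.length_sort (s := t) (r := (· ≤ ·))
  rw [← Multiset.sort_eq s (· ≤ ·), ← Multiset.sort_eq t (· ≤ ·), Multiset.coe_countP, 
    Multiset.coe_countP] at h
  generalize s.sort (· ≤ ·) = S at *
  generalize t.sort (· ≤ ·) = T at *
  rw [← List.take_append_drop i S, ← List.take_append_drop (i+1) T, List.countP_append,
    List.countP_append] at h
  have e1 : (S.drop i).countP (fun y => decide (x < y)) = (S.drop i).length := by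
    rw [List.countP_eq_length]
    intro a ha
    obtain ⟨j, hj, rfl⟩ := List.mem_iff_getElem.1 ha
    rw [List.getElem_drop]
    simp only [decide_eq_true_eq]
    refine hx.2.trans_le ?_
    exact ps.rel_get_of_le (a := ⟨i, hi⟩) (b := ⟨i+j, by simp at hj; omega⟩) (by simp)
  have e2 : (T.take (i+1)).countP (fun y => decide (x < y)) = 0 := by
    rw [List.countP_eq_zero]
    intro a ha
    obtain ⟨j, hj, rfl⟩ := List.mem_iff_getElem.1 ha
    rw [List.getElem_take]
    simp only [decide_eq_true_eq, not_lt]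
    refine le_trans ?_ hx.1.le
    simp at hj
    exact pt.rel_get_of_le (a := ⟨j, by omega⟩) (b := ⟨i, hi'⟩) (by simp; omega)
  have e3 := List.countP_le_length (p := fun y => decide (x < y)) (l := T.drop (i+1))
  rw [List.length_drop] at e1 e3
  omega

def Dom (p q : ℝ[X]) (n : ℕ) : Prop :=
  p.natDegree = n ∧ q.natDegree = n ∧ ∃ r s : Fin n → ℝ, (∀ i, r i ≤ s i) ∧
    p.roots = Finset.univ.val.map r ∧ q.roots = Finset.univ.val.map s

theorem roots_sort_map (u : Multiset ℝ) (n : ℕ) (h : u.card = n) :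
    u = Finset.univ.val.map (fun i : Fin n => (u.sort (· ≤ ·))[(i:ℕ)]'(by simp [h])) := by
  subst h
  conv_lhs => rw [← Multiset.sort_eq u (· ≤ ·)]
  have : ∀ (L : List ℝ) (n : ℕ) (h : L.length = n), (L : Multiset ℝ) =
      Finset.univ.val.map (fun i : Fin n => L[(i:ℕ)]'(by omega)) := by
    rintro L n rfl
    rw [Fin.univ_val_map]
    congr 1
    exact (List.ofFn_getElem (xs := L)).symm
  exact this _ _ (by simp)

theorem Dom.count {p q : ℝ[X]} {n : ℕ} (h : Dom p q n) (t : ℝ) :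
    p.roots.countP (t < ·) ≤ q.roots.countP (t < ·) := by
  obtain ⟨-, -, r, s, hrs, hr, hs⟩ := h
  rw [hr, hs, Multiset.countP_map, Multiset.countP_map]
  exact Multiset.card_le_card (Multiset.monotone_filter_right _ fun i hi => hi.trans_le (hrs i))

theorem Dom.count_eq {p q : ℝ[X]} {n : ℕ} (h : Dom p q n) (t : ℝ)
    (hp : t ∉ p.roots) (hq : t ∉ q.roots)
    (hc : p.roots.countP (t < ·) = q.roots.countP (t < ·)) :
    (p.roots.map (fun a => 1 / (t - a))).sum ≤ (q.roots.map (fun a => 1 / (t - a))).sum := by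
  obtain ⟨-, -, r, s, hrs, hr, hs⟩ := h
  rw [hr, hs, Multiset.countP_map, Multiset.countP_map] at hc
  rw [hr] at hp
  rw [hs] at hq
  have hp' : ∀ i, r i ≠ t := fun i hi => hp (by simpa using ⟨i, hi⟩)
  have hq' : ∀ i, s i ≠ t := fun i hi => hq (by simpa using ⟨i, hi⟩)
  have key : (Finset.univ.filter fun i => t < r i) = (Finset.univ.filter fun i => t < s i) := by
    refine Finset.eq_of_subset_of_card_le ?_ hc.ge
    intro i
    simp only [Finset.mem_filter, Finset.mem_univ, true_and]
    exact fun h => h.trans_le (hrs i)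
  rw [hr, hs, Multiset.map_map, Multiset.map_map]
  refine Finset.sum_le_sum (s := Finset.univ) fun i _ => ?_
  have hi := congrArg (fun S => i ∈ S) key
  simp only [Finset.mem_filter, Finset.mem_univ, true_and, eq_iff_iff] at hi
  simp only [Function.comp]
  by_cases h : t < r i
  · exact one_div_le_one_div_of_neg_of_le (by linarith [hi.1 h]) (by linarith [hrs i])
  · have h' : s i < t := lt_of_le_of_ne (not_lt.1 (fun h'' => h (hi.2 h''))) (hq' i)
    exact one_div_le_one_div_of_le (by linarith) (by linarith [hrs i])

theorem Dom.derivative {p q : ℝ[X]} {n : ℕ} (h : Dom p q (n+1)) :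
    Dom p.derivative q.derivative n := by
  have hcount := h.count
  have hceq := h.count_eq
  obtain ⟨dp, dq, r, s, -, hr, hs⟩ := h
  have cp : p.roots.card = p.natDegree := by rw [hr, dp]; simp
  have cq : q.roots.card = q.natDegree := by rw [hs, dq]; simp
  obtain ⟨p1, p2, p3⟩ := count_facts p cp (by omega)
  obtain ⟨q1, q2, q3⟩ := count_facts q cq (by omega)
  have p1' : p.derivative.roots.card = n := by omega
  have q1' : q.derivative.roots.card = n := by omega
  refine ⟨by omega, by omega, _, _, ?_, roots_sort_map _ n p1', roots_sort_map _ n q1'⟩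
  intro i
  have hp0 : p ≠ 0 := by rintro rfl; simp at dp
  have hq0 : q ≠ 0 := by rintro rfl; simp at dq
  have hp0' : p.derivative ≠ 0 := by
    intro h; have := natDegree_eq_zero_of_derivative_eq_zero h; omega
  have hq0' : q.derivative ≠ 0 := by
    intro h; have := natDegree_eq_zero_of_derivative_eq_zero h; omega
  refine sorted_le _ _ {x | (p * q * (p.derivative * q.derivative)).IsRoot x}
    (finite_setOf_isRoot (by simp [*])) (by omega) ?_ i _ _
  intro t ht
  simp only [Set.mem_setOf_eq, IsRoot, eval_mul, mul_eq_zero, not_or] at ht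
  obtain ⟨⟨h1, h2⟩, h3, h4⟩ := ht
  by_contra! hlt
  have a1 := hcount t
  have a2 := p3 t
  have a3 := q3 t
  have e1 : p.derivative.roots.countP (t < ·) = p.roots.countP (t < ·) := by omega
  have e2 : p.roots.countP (t < ·) = q.roots.countP (t < ·) := by omega
  have e3 : q.roots.countP (t < ·) = q.derivative.roots.countP (t < ·) + 1 := by omega
  have f1 := hceq t (by rw [mem_roots hp0]; exact h1) (by rw [mem_roots hq0]; exact h2) e2
  have g1 := parity p cp (by omega) t h1 h3
  have g2 := parity q cq (by omega) t h2 h4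
  rw [e1, Even.neg_one_pow ⟨_, rfl⟩] at g1
  rw [e3, Odd.neg_one_pow ⟨q.derivative.roots.countP (t < ·), by ring⟩] at g2
  linarith

theorem Dom.iterate (k : ℕ) : ∀ {p q : ℝ[X]} {n : ℕ}, Dom p q (n+k) →
    Dom (Polynomial.derivative^[k] p) (Polynomial.derivative^[k] q) n := by
  induction k with
  | zero => intro p q n h; exact h
  | succ k ih => intro p q n h; exact ih (Dom.derivative h)

theorem hasse_eq (k : ℕ) (p : ℝ[X]) :
    hasseDeriv k p = C ((k.factorial : ℝ)⁻¹) * Polynomial.derivative^[k] p := by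
  rw [← factorial_smul_hasseDeriv]
  have : (k.factorial : ℝ) ≠ 0 := by positivity
  simp only [LinearMap.smul_apply]
  rw [nsmul_eq_mul, ← mul_assoc, ← C_eq_natCast, ← C_mul, inv_mul_cancel₀ this]
  simp

theorem Dom.hasse {p q : ℝ[X]} {n k : ℕ} (h : Dom p q (n+k)) :
    Dom (hasseDeriv k p) (hasseDeriv k q) n := by
  have := h.iterate k
  have h0 : (k.factorial : ℝ)⁻¹ ≠ 0 := by positivity
  rw [hasse_eq, hasse_eq]
  unfold Dom
  rw [natDegree_C_mul h0, natDegree_C_mul h0, roots_C_mul _ h0, roots_C_mul _ h0]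
  exact this

theorem Dom.nth {p q : ℝ[X]} {n m : ℕ} (h : Dom p q n) (h1 : 1 ≤ m) (h2 : m ≤ n) :
    nthSmallestRoot p m ≤ nthSmallestRoot q m := by
  have hc := h.count
  obtain ⟨-, -, r, s, -, hr, hs⟩ := h
  have cp : p.roots.card = n := by rw [hr]; simp
  have cq : q.roots.card = n := by rw [hs]; simp
  have l1 : m - 1 < (p.roots.sort (· ≤ ·)).length := by simp; omega
  have l2 : m - 1 < (q.roots.sort (· ≤ ·)).length := by simp; omega
  unfold nthSmallestRoot
  rw [List.getD_eq_getElem _ _ l1, List.getD_eq_getElem _ _ l2]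
  exact sorted_le _ _ ∅ Set.finite_empty (by omega) (fun x _ => hc x) _ _ _

theorem Dom.root_left {p q : ℝ[X]} {n m : ℕ} (h : Dom p q n) (h1 : 1 ≤ m) (h2 : m ≤ n) :
    p.IsRoot (nthSmallestRoot p m) := by
  obtain ⟨-, -, r, s, -, hr, hs⟩ := h
  have cp : p.roots.card = n := by rw [hr]; simp
  have l1 : m - 1 < (p.roots.sort (· ≤ ·)).length := by simp; omega
  unfold nthSmallestRoot
  rw [List.getD_eq_getElem _ _ l1]
  apply isRoot_of_mem_roots
  rw [← Multiset.mem_sort (· ≤ ·)]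
  exact List.getElem_mem l1

/-- Monic polynomial with the given roots. -/
noncomputable def PP {n : ℕ} (r : Fin n → ℝ) : ℝ[X] := ∏ i, (X - C (r i))

theorem PP_roots {n : ℕ} (r : Fin n → ℝ) : (PP r).roots = Finset.univ.val.map r := by
  have : PP r = ((Finset.univ.val.map r).map (fun a => X - C a)).prod := by
    rw [Multiset.map_map]; rfl
  rw [this, roots_multiset_prod_X_sub_C]

theorem PP_monic {n : ℕ} (r : Fin n → ℝ) : (PP r).Monic :=
  monic_prod_of_monic _ _ fun i _ => monic_X_sub_C _

theorem PP_deg {n : ℕ} (r : Fin n → ℝ) : (PP r).natDegree = n := by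
  unfold PP
  rw [natDegree_prod_of_monic _ _ fun i _ => monic_X_sub_C _]
  simp

theorem PP_dom {n : ℕ} (r s : Fin n → ℝ) (h : ∀ i, r i ≤ s i) : Dom (PP r) (PP s) n :=
  ⟨PP_deg r, PP_deg s, r, s, h, PP_roots r, PP_roots s⟩

theorem const_root (d k : ℕ) (hk : k < d) (a x : ℝ)
    (h : (hasseDeriv k (PP (fun _ : Fin d => a))).IsRoot x) : x = a := by
  unfold PP at h
  rw [hasse_eq, Finset.prod_const, Finset.card_univ, Fintype.card_fin,
    iterate_derivative_X_sub_pow] at h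
  have h0 : (k.factorial : ℝ) ≠ 0 := by positivity
  have h1 : (d.descFactorial k : ℝ) ≠ 0 := by
    exact_mod_cast (Nat.descFactorial_pos.2 hk.le).ne'
  simp [IsRoot, h0, h1] at h
  have := h.1
  linarith

theorem nth_const (d k m : ℕ) (hk : k < d) (h1 : 1 ≤ m) (h2 : m ≤ d - k) (a : ℝ) :
    nthSmallestRoot (hasseDeriv k (PP (fun _ : Fin d => a))) m = a := by
  apply const_root d k hk
  have := PP_dom (fun _ : Fin d => a) (fun _ : Fin d => a) (fun _ => le_rfl)
  have e : d = (d - k) + k := by omega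
  have h : Dom (PP (fun _ : Fin d => a)) (PP (fun _ : Fin d => a)) ((d - k) + k) := by
    rw [← e]; exact this
  exact h.hasse.root_left h1 h2

theorem nth_mono (d k m : ℕ) (hk : k < d) (h1 : 1 ≤ m) (h2 : m ≤ d - k) (r s : Fin d → ℝ)
    (hrs : ∀ i, r i ≤ s i) :
    nthSmallestRoot (hasseDeriv k (PP r)) m ≤ nthSmallestRoot (hasseDeriv k (PP s)) m := by
  have := PP_dom r s hrs
  have e : d = (d - k) + k := by omega
  have h : Dom (PP r) (PP s) ((d - k) + k) := by rw [← e]; exact this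
  exact h.hasse.nth h1 h2

theorem draisma_deJong (d : ℕ) (hd : 2 ≤ d)
    (k m : Fin (d - 2) → ℕ)
    (hkmono : StrictMono k)
    (hk : ∀ j, 1 ≤ k j ∧ k j ≤ d - 1)
    (hm : ∀ j, 1 ≤ m j ∧ m j ≤ d - k j) :
    ∃ f : Polynomial ℝ, f.Monic ∧ f.natDegree = d ∧
      f.eval 0 = 0 ∧ f.eval 1 = 0 ∧
      Multiset.card f.roots = d ∧
      (∀ x ∈ f.roots, x ∈ Set.Icc (0 : ℝ) 1) ∧
      ∀ j, f.IsRoot (nthSmallestRoot (Polynomial.hasseDeriv (k j) f) (m j)) := by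
  obtain ⟨e, rfl⟩ : ∃ e, d = e + 2 := ⟨d - 2, by omega⟩
  have hkd : ∀ j, k j < e + 2 := fun j => by have := hk j; omega
  haveI : Fact ((0:ℝ) ≤ 1) := ⟨zero_le_one⟩
  let R : (Fin e → Set.Icc (0:ℝ) 1) → Fin (e + 2) → ℝ := fun x =>
    Fin.cons 0 (Fin.cons 1 (fun i => (x i : ℝ)))
  have R0 : ∀ x, R x 0 = 0 := fun x => rfl
  have R1 : ∀ x, R x 1 = 1 := fun x => rfl
  have R2 : ∀ x (i : Fin e), R x i.succ.succ = x i := fun x i => rfl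
  have Rmem : ∀ x i, R x i ∈ Set.Icc (0:ℝ) 1 := by
    intro x i
    refine Fin.cases ?_ (fun i => Fin.cases ?_ (fun i => ?_) i) i
    · simp [R0]
    · change (1:ℝ) ∈ _
      simp
    · rw [R2]; exact (x i).2
  have Rmono : ∀ x y, x ≤ y → ∀ i, R x i ≤ R y i := by
    intro x y hxy i
    refine Fin.cases ?_ (fun i => Fin.cases ?_ (fun i => ?_) i) i
    · exact le_rfl
    · exact le_rfl
    · rw [R2, R2]; exact hxy i
  let φ : (Fin e → Set.Icc (0:ℝ) 1) →o (Fin e → Set.Icc (0:ℝ) 1) :=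
    { toFun := fun x j => ⟨nthSmallestRoot (hasseDeriv (k j) (PP (R x))) (m j), by
        constructor
        · rw [← nth_const (e+2) (k j) (m j) (hkd j) (hm j).1 (hm j).2 0]
          exact nth_mono _ _ _ (hkd j) (hm j).1 (hm j).2 _ _ fun i => (Rmem x i).1
        · rw [← nth_const (e+2) (k j) (m j) (hkd j) (hm j).1 (hm j).2 1]
          exact nth_mono _ _ _ (hkd j) (hm j).1 (hm j).2 _ _ fun i => (Rmem x i).2⟩
      monotone' := fun x y hxy j =>
        nth_mono _ _ _ (hkd j) (hm j).1 (hm j).2 _ _ (Rmono x y hxy) }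
  have hfix : φ φ.lfp = φ.lfp := φ.map_lfp
  generalize φ.lfp = x at hfix
  have hroot : ∀ i, (PP (R x)).IsRoot (R x i) := by
    intro i
    apply isRoot_of_mem_roots
    rw [PP_roots]
    exact Multiset.mem_map_of_mem _ (Finset.mem_univ i)
  refine ⟨PP (R x), PP_monic _, PP_deg _, hroot 0, hroot 1, ?_, ?_, ?_⟩
  · rw [PP_roots]; simp
  · intro y hy
    rw [PP_roots] at hy
    simp only [Multiset.mem_map, Finset.mem_val, Finset.mem_univ, true_and] at hy
    obtain ⟨i, rfl⟩ := hy
    exact Rmem x i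
  · intro j
    have hj : nthSmallestRoot (hasseDeriv (k j) (PP (R x))) (m j) = x j :=
      congrArg Subtype.val (congrFun hfix j)
    rw [hj, ← R2]
    exact hroot _
end

section
/- Fix d ≥ 2 and fix i ∈ {1, …, d-1}. Then there exists a monic polynomial f ∈ ℝ[x] of degree d such that f(0) = 0, f(1) = 0, all roots of f are real and lie in the closed interval [0,1], and for every k ∈ {1, …, d-1} with k ≠ i, the smallest root of the Hasse derivative H_k(f) is a root of f. -/
open Polynomial

/-- The smallest real root of a real polynomial `g`: the first entry of the multiset of
real roots of `g` sorted in weakly increasing order (with junk value `0` if `g` has no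
real roots). -/
noncomputable def smallestRoot (g : Polynomial ℝ) : ℝ :=
  (g.roots.sort (· ≤ ·)).headD 0

structure RR (n : ℕ) (p : Polynomial ℝ) : Prop where
  deg : p.natDegree = n
  lc : 0 < p.leadingCoeff
  spl : p.Splits

lemma RR.ne {n p} (h : RR n p) : p ≠ 0 := by
  rintro rfl
  simpa using h.lc

lemma RR.der {n p} (h : RR (n+1) p) : RR n (derivative p) := by
  have hd : (derivative p).natDegree = n := by
    have := degree_derivative_eq p (by rw [h.deg]; omega)
    rw [h.deg] at this
    exact natDegree_eq_of_degree_eq_some (by simpa using this)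
  refine ⟨hd, ?_, ?_⟩
  · rw [leadingCoeff_derivative, h.deg]
    have := h.lc
    positivity
  · rw [splits_iff_card_roots]
    have h1 := card_roots_le_derivative p
    have h2 := card_roots' (derivative p)
    have h3 := splits_iff_card_roots.1 h.spl
    have := h.deg
    omega

lemma RR.iter {n p} (k : ℕ) (h : RR (n+k) p) : RR n (derivative^[k] p) := by
  induction k generalizing p with
  | zero => simpa using h
  | succ k ih =>
    rw [Function.iterate_succ_apply]
    exact ih (RR.der h)

lemma RR.xmul {n h} (a : ℝ) (hh : RR n h) : RR (n+1) ((X - C a) * h) := by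
  refine ⟨?_, ?_, ?_⟩
  · rw [natDegree_mul (X_sub_C_ne_zero a) hh.ne, natDegree_X_sub_C, hh.deg, add_comm]
  · simpa using hh.lc
  · exact (Splits.X_sub_C a).mul hh.spl

lemma RR.sgn_eval {n p} (h : RR n p) (y : ℝ) :
    (-1)^n * p.eval y = p.leadingCoeff * (p.roots.map (fun r => r - y)).prod := by
  have hc := splits_iff_card_roots.1 h.spl
  rw [h.spl.eval_eq_prod_roots]
  have : (p.roots.map (fun r => r - y)).prod = (-1)^n * (p.roots.map (y - ·)).prod := by
    rw [← h.deg, ← hc]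
    rw [← Multiset.card_map (fun r => y - r) p.roots, ← Multiset.prod_map_neg]
    simp
  rw [this]; ring

lemma RR.pos {n p} (h : RR n p) {y : ℝ} (hy : ∀ r ∈ p.roots, y < r) :
    0 < (-1)^n * p.eval y := by
  rw [h.sgn_eval]
  refine mul_pos h.lc (Multiset.prod_pos ?_)
  intro a ha
  obtain ⟨r, hr, rfl⟩ := Multiset.mem_map.1 ha
  linarith [hy r hr]

lemma RR.nonneg {n p} (h : RR n p) {y : ℝ} (hy : ∀ r ∈ p.roots, y ≤ r) :
    0 ≤ (-1)^n * p.eval y := by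
  rw [h.sgn_eval]
  refine mul_nonneg h.lc.le (Multiset.prod_nonneg ?_)
  intro a ha
  obtain ⟨r, hr, rfl⟩ := Multiset.mem_map.1 ha
  linarith [hy r hr]

lemma RR.der_ne {n p} (h : RR (n+1) p) {y : ℝ} (hy : ∀ r ∈ p.roots, y < r) :
    (derivative p).eval y ≠ 0 := by
  have hp : p.eval y ≠ 0 := by
    intro h0
    have := h.pos hy
    rw [h0] at this; simp at this
  have h1 := h.spl.eval_derivative_div_eval_of_ne_zero hp
  intro h0
  rw [h0, zero_div] at h1
  have h3 := splits_iff_card_roots.1 h.spl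
  rw [h.deg] at h3
  have : 0 < (p.roots.map (fun z => 1 / (z - y))).sum := by
    obtain ⟨a, ha⟩ := Multiset.card_pos_iff_exists_mem.1 (by omega : 0 < p.roots.card)
    obtain ⟨t, ht⟩ := Multiset.exists_cons_of_mem ha
    rw [ht] at hy ⊢
    rw [Multiset.map_cons, Multiset.sum_cons]
    refine add_pos_of_pos_of_nonneg ?_ (Multiset.sum_nonneg ?_)
    · have := hy a (by simp)
      exact one_div_pos.2 (by linarith)
    · intro x hx
      obtain ⟨r, hr, rfl⟩ := Multiset.mem_map.1 hx
      have := hy r (by simp [hr])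
      exact (one_div_pos.2 (by linarith)).le
  have e : (p.roots.map (fun z => 1 / (z - y))).sum = - (p.roots.map (fun z => 1 / (y - z))).sum := by
    rw [← Multiset.sum_map_neg]
    congr 1
    refine Multiset.map_congr rfl fun z _ => ?_
    rw [← neg_sub y z, one_div, one_div, inv_neg]
  rw [e, ← h1] at this
  simp at this

lemma RR.key {n p} (h : RR (n+1) p) {m : ℝ} (hm : (derivative p).eval m = 0)
    (hmin : ∀ r ∈ (derivative p).roots, m ≤ r) : (-1)^(n+1) * p.eval m ≤ 0 := by
  by_contra! hc
  refine h.der_ne (y := m) ?_ hm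
  intro r hr
  by_contra! hle
  have hr0 : p.eval r = 0 := (mem_roots'.1 hr).2
  have hanti : AntitoneOn (fun y => (-1)^(n+1) * p.eval y) (Set.Iic m) := by
    apply antitoneOn_of_deriv_nonpos (convex_Iic m)
    · fun_prop
    · fun_prop
    · intro x hx
      rw [interior_Iic] at hx
      have hx' : x < m := hx
      have := h.der.nonneg (y := x) fun r hr => (hx'.trans_le (hmin r hr)).le
      rw [deriv_const_mul _ (by fun_prop), Polynomial.deriv, pow_succ]
      linarith
  have := hanti (Set.mem_Iic.2 hle) (Set.mem_Iic.2 le_rfl) hle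
  simp only [hr0] at this
  linarith

lemma iter_xmul (k : ℕ) (a : ℝ) (h : ℝ[X]) :
    derivative^[k+1] ((X - C a) * h) =
      (X - C a) * derivative^[k+1] h + (k+1 : ℝ[X]) * derivative^[k] h := by
  rw [sub_mul, mul_comm X h, iterate_derivative_sub, iterate_derivative_mul_X,
    iterate_derivative_C_mul]
  simp only [Nat.add_sub_cancel, nsmul_eq_mul]
  push_cast
  ring

lemma step1 {n k h} (a x : ℝ) (hh : RR (n+(k+1)) h)
    (hx : ∀ r ∈ (derivative^[k+1] ((X - C a) * h)).roots, x ≤ r) :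
    ∀ r ∈ (derivative^[k+1] h).roots, x ≤ r := by
  intro r hr
  have hp : RR (n+1) (derivative^[k] h) := RR.iter k (by convert hh using 1; omega)
  have hF : RR (n+1) (derivative^[k+1] ((X - C a) * h)) :=
    RR.iter (k+1) (by convert hh.xmul a using 1; omega)
  obtain ⟨m, hm, hmin⟩ := Finset.exists_min_image (derivative^[k+1] h).roots.toFinset id
    ⟨r, by simpa using hr⟩
  simp only [Multiset.mem_toFinset, id] at hm hmin
  have hm0 : (derivative^[k+1] h).eval m = 0 := (mem_roots'.1 hm).2
  have e : derivative^[k+1] h = derivative (derivative^[k] h) := Function.iterate_succ_apply' _ _ _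
  have hk := hp.key (m := m) (by rw [← e]; exact hm0) (by rw [← e]; exact hmin)
  have hle : ¬ ∀ r ∈ (derivative^[k+1] ((X - C a) * h)).roots, m < r := by
    intro hall
    have := hF.pos hall
    rw [iter_xmul, eval_add, eval_mul, hm0, eval_mul] at this
    simp only [mul_zero, zero_add, eval_add, eval_natCast, eval_one] at this
    have h2 : (0:ℝ) < (k:ℝ) + 1 := by positivity
    nlinarith
  push Not at hle
  obtain ⟨s, hs, hsm⟩ := hle
  exact (hx s hs).trans (hsm.trans (hmin r hr))

lemma step2 {n k h} (a b x : ℝ) (hab : a ≤ b) (hh : RR (n+(k+1)) h)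
    (hx : ∀ r ∈ (derivative^[k+1] ((X - C a) * h)).roots, x ≤ r) :
    ∀ r ∈ (derivative^[k+1] ((X - C b) * h)).roots, x ≤ r := by
  intro r hr
  by_contra! hlt
  have hF : RR (n+1) (derivative^[k+1] ((X - C a) * h)) :=
    RR.iter (k+1) (by convert hh.xmul a using 1; omega)
  have hH : RR n (derivative^[k+1] h) := RR.iter (k+1) hh
  have h1 := hF.pos (y := r) fun s hs => hlt.trans_le (hx s hs)
  have h2 := hH.nonneg (y := r) fun s hs => (hlt.trans_le (step1 a x hh hx s hs)).le
  have h3 : (derivative^[k+1] ((X - C b) * h)).eval r = 0 := (mem_roots'.1 hr).2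
  rw [iter_xmul] at h1 h3
  simp only [eval_add, eval_mul, eval_sub, eval_X, eval_C] at h1 h3
  rw [pow_succ] at h1
  have h4 := mul_nonneg (sub_nonneg.2 hab) h2
  have h5 : (eval r (k : ℝ[X]) + eval r 1) * eval r (derivative^[k] h)
    = - ((r - b) * eval r (derivative^[k+1] h)) := by linarith
  rw [h5] at h1
  nlinarith

lemma RR.prod {ι : Type*} (s : Finset ι) (a : ι → ℝ) {n q} (hq : RR n q) :
    RR (n + s.card) (q * ∏ j ∈ s, (X - C (a j))) := by
  classical
  induction s using Finset.induction_on with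
  | empty => simpa using hq
  | insert j s hj ih =>
    rw [Finset.prod_insert hj, Finset.card_insert_of_notMem hj, mul_left_comm]
    exact ih.xmul _

lemma mono_prod {ι : Type*} (s : Finset ι) (a b : ι → ℝ) (hab : ∀ j, a j ≤ b j) (k : ℕ) (x : ℝ)
    {n q} (hq : RR n q) (hk : k + 1 < n + s.card)
    (hx : ∀ r ∈ (derivative^[k+1] (q * ∏ j ∈ s, (X - C (a j)))).roots, x ≤ r) :
    ∀ r ∈ (derivative^[k+1] (q * ∏ j ∈ s, (X - C (b j)))).roots, x ≤ r := by
  classical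
  induction s using Finset.induction_on generalizing n q with
  | empty => simpa using hx
  | insert j s hj ih =>
    rw [Finset.card_insert_of_notMem hj] at hk
    rw [Finset.prod_insert hj] at hx ⊢
    have := ih (hq.xmul (b j)) (by omega) (by
      rw [mul_assoc]
      refine step2 (n := n + s.card - (k+1)) (a j) (b j) x (hab j) ?_ ?_
      · convert hq.prod s a using 1; omega
      · rw [← mul_left_comm]; exact hx)
    rw [mul_assoc, mul_left_comm] at this
    exact this

lemma smallestRoot_spec {g : ℝ[X]} (h : g.roots ≠ 0) :
    smallestRoot g ∈ g.roots ∧ ∀ r ∈ g.roots, smallestRoot g ≤ r := by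
  unfold smallestRoot
  have hp := Multiset.pairwise_sort g.roots (· ≤ ·)
  have hm : ∀ a, a ∈ g.roots.sort (· ≤ ·) ↔ a ∈ g.roots := fun a => Multiset.mem_sort (· ≤ ·)
  cases hl : g.roots.sort (· ≤ ·) with
  | nil =>
    exfalso; apply h
    rw [Multiset.eq_zero_iff_forall_notMem]
    intro a ha
    rw [← hm, hl] at ha; simp at ha
  | cons a l =>
    rw [hl] at hp hm
    simp only [List.headD_cons]
    refine ⟨(hm a).1 (by simp), fun r hr => ?_⟩
    rcases List.mem_cons.1 ((hm r).2 hr) with rfl | h'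
    · exact le_rfl
    · exact (List.pairwise_cons.1 hp).1 r h'

lemma smallestRoot_hasse (k : ℕ) (f : ℝ[X]) :
    smallestRoot (hasseDeriv k f) = smallestRoot (derivative^[k] f) := by
  unfold smallestRoot
  have : derivative^[k] f = C (k.factorial : ℝ) * hasseDeriv k f := by
    rw [← factorial_smul_hasseDeriv]
    simp
  rw [this, roots_C_mul _ (by exact_mod_cast k.factorial_ne_zero)]

lemma RR.sr {n p} (h : RR (n+1) p) :
    smallestRoot p ∈ p.roots ∧ ∀ r ∈ p.roots, smallestRoot p ≤ r := by
  apply smallestRoot_spec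
  have h3 := splits_iff_card_roots.1 h.spl
  rw [h.deg] at h3
  rw [← Multiset.card_pos]; omega

lemma RR_one : RR 0 (1 : ℝ[X]) := ⟨by simp, by simp, by simp⟩

/-- main monotonicity -/
lemma sr_mono {ι : Type*} (s : Finset ι) (a b : ι → ℝ) (hab : ∀ j, a j ≤ b j) (k : ℕ)
    (hk1 : 1 ≤ k) (hk : k < s.card) :
    smallestRoot (derivative^[k] (∏ j ∈ s, (X - C (a j)))) ≤
    smallestRoot (derivative^[k] (∏ j ∈ s, (X - C (b j)))) := by
  obtain ⟨k, rfl⟩ : ∃ k', k = k' + 1 := ⟨k - 1, by omega⟩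
  have hR : ∀ c : ι → ℝ, RR (s.card - (k+1) - 1 + 1) (derivative^[k+1] (∏ j ∈ s, (X - C (c j)))) := by
    intro c
    apply RR.iter
    have := RR_one.prod s c
    rw [one_mul] at this
    convert this using 1
    omega
  have := mono_prod s a b hab k (smallestRoot (derivative^[k+1] (∏ j ∈ s, (X - C (a j)))))
    RR_one (by omega) (by rw [one_mul]; exact (hR a).sr.2)
  rw [one_mul] at this
  exact this _ (hR b).sr.1

lemma sr_const {ι : Type*} (s : Finset ι) (c : ℝ) (k : ℕ) (hk : k < s.card) :
    smallestRoot (derivative^[k] (∏ j ∈ s, (X - C c))) = c := by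
  rw [Finset.prod_const, iterate_derivative_X_sub_pow]
  have hr : (s.card.descFactorial k • (X - C c) ^ (s.card - k)).roots =
      Multiset.replicate (s.card - k) c := by
    rw [nsmul_eq_mul, ← C_eq_natCast, roots_C_mul, roots_pow, roots_X_sub_C,
      Multiset.nsmul_singleton]
    exact_mod_cast (Nat.descFactorial_pos.2 hk.le).ne'
  have := (smallestRoot_spec (g := s.card.descFactorial k • (X - C c) ^ (s.card - k))
    (by rw [hr, ← Multiset.card_pos, Multiset.card_replicate]; omega)).1
  rw [hr] at this
  exact Multiset.eq_of_mem_replicate this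

/-- index `0` is the root 0, index `i` is the root 1, others are free -/
noncomputable def rts (i : ℕ) (m : ℕ → Set.Icc (0:ℝ) 1) (j : ℕ) : ℝ :=
  if j = 0 then 0 else if j = i then 1 else m j

lemma rts_mem (i m j) : rts i m j ∈ Set.Icc (0:ℝ) 1 := by
  unfold rts
  split_ifs
  · simp
  · simp
  · exact (m j).2

noncomputable def fp (d i : ℕ) (m : ℕ → Set.Icc (0:ℝ) 1) : ℝ[X] :=
  ∏ j ∈ Finset.range d, (X - C (rts i m j))

lemma fp_bd (d i m k) (hk1 : 1 ≤ k) (hk : k < d) :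
    smallestRoot (derivative^[k] (fp d i m)) ∈ Set.Icc (0:ℝ) 1 := by
  have hk' : k < (Finset.range d).card := by simpa using hk
  constructor
  · rw [← sr_const (Finset.range d) 0 k hk']
    exact sr_mono _ (fun _ => 0) _ (fun j => (rts_mem i m j).1) k hk1 hk'
  · rw [← sr_const (Finset.range d) 1 k hk']
    exact sr_mono _ _ (fun _ => 1) (fun j => (rts_mem i m j).2) k hk1 hk'

noncomputable def Tm (d i : ℕ) (m : ℕ → Set.Icc (0:ℝ) 1) (k : ℕ) : Set.Icc (0:ℝ) 1 :=
  if h : 1 ≤ k ∧ k < d then ⟨smallestRoot (derivative^[k] (fp d i m)), fp_bd d i m k h.1 h.2⟩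
  else 0

lemma Tm_mono (d i) : Monotone (Tm d i) := by
  intro m m' hm k
  unfold Tm
  split_ifs with h
  · rw [Subtype.mk_le_mk]
    refine sr_mono _ _ _ (fun j => ?_) k h.1 (by simpa using h.2)
    unfold rts
    split_ifs
    · exact le_rfl
    · exact le_rfl
    · exact hm j
  · exact le_rfl

theorem almost_counterexample_exists (d : ℕ) (hd : 2 ≤ d)
    (i : ℕ) (hi1 : 1 ≤ i) (hi2 : i ≤ d - 1) :
    ∃ f : Polynomial ℝ, f.Monic ∧ f.natDegree = d ∧
      f.eval 0 = 0 ∧ f.eval 1 = 0 ∧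
      Multiset.card f.roots = d ∧
      (∀ x ∈ f.roots, x ∈ Set.Icc (0 : ℝ) 1) ∧
      ∀ k : ℕ, 1 ≤ k → k ≤ d - 1 → k ≠ i →
        f.IsRoot (smallestRoot (Polynomial.hasseDeriv k f)) := by
  obtain ⟨m, hm⟩ : ∃ m, Tm d i m = m := by
    haveI : Fact ((0:ℝ) ≤ 1) := ⟨zero_le_one⟩
    exact ⟨_, OrderHom.map_lfp (⟨Tm d i, Tm_mono d i⟩ : (ℕ → Set.Icc (0:ℝ) 1) →o _)⟩
  have hroot : ∀ j < d, (fp d i m).eval (rts i m j) = 0 := by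
    intro j hj
    unfold fp
    rw [eval_prod]
    exact Finset.prod_eq_zero (Finset.mem_range.2 hj) (by simp)
  have hroots : (fp d i m).roots = (Finset.range d).val.map (rts i m) := by
    have := roots_multiset_prod_X_sub_C ((Finset.range d).val.map (rts i m))
    rw [Multiset.map_map] at this
    exact this
  refine ⟨fp d i m, monic_prod_of_monic _ _ fun j _ => monic_X_sub_C _, ?_, ?_, ?_, ?_, ?_, ?_⟩
  · unfold fp; rw [natDegree_prod_of_monic _ _ fun j _ => monic_X_sub_C _]; simp
  · simpa [rts] using hroot 0 (by omega)
  · have := hroot i (by omega)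
    rwa [rts, if_neg (by omega), if_pos rfl] at this
  · simp [hroots]
  · intro x hx
    rw [hroots] at hx
    obtain ⟨j, -, rfl⟩ := Multiset.mem_map.1 hx
    exact rts_mem i m j
  · intro k hk1 hk2 hki
    rw [smallestRoot_hasse]
    have h1 := hroot k (by omega)
    have h2 : ((Tm d i m k : Set.Icc (0:ℝ) 1) : ℝ) = m k := by rw [hm]
    rw [Tm, dif_pos ⟨hk1, by omega⟩] at h2
    rw [rts, if_neg (by omega), if_neg hki, ← h2] at h1
    exact h1
end

section
/- Let f ∈ ℂ[x] be a monic polynomial of degree d ≥ 1 such that for every i ∈ {1, …, d-1}, the polynomials f and H_i(f) have a common root in ℂ. If f has at most 4 distinct roots in ℂ, then f = (x - b)^d for some b ∈ ℂ. -/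
open Polynomial

def CAM (s : Multiset ℂ) : Prop :=
  ∀ k, 1 ≤ k → k < s.card → ∃ x ∈ s, (s.map (fun z => z - x)).esymm k = 0

lemma esymm_cons_succ (a : ℂ) (s : Multiset ℂ) (k : ℕ) :
    (a ::ₘ s).esymm (k + 1) = s.esymm (k + 1) + a * s.esymm k := by
  simp [Multiset.esymm, Multiset.powersetCard_cons, Multiset.sum_map_mul_left]

lemma esymm_zero' (s : Multiset ℂ) : s.esymm 0 = 1 := by
  simp [Multiset.esymm]

lemma esymm_nil_succ (k : ℕ) : (0 : Multiset ℂ).esymm (k + 1) = 0 := by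
  simp [Multiset.esymm, Multiset.powersetCard_zero_right]

lemma newton_ids (s : Multiset ℂ) :
    (s.map (fun z => z)).sum = s.esymm 1 ∧
    (s.map (fun z => z ^ 2)).sum = s.esymm 1 ^ 2 - 2 * s.esymm 2 ∧
    (s.map (fun z => z ^ 3)).sum = s.esymm 1 ^ 3 - 3 * s.esymm 1 * s.esymm 2 + 3 * s.esymm 3 ∧
    (s.map (fun z => z ^ 4)).sum = s.esymm 1 ^ 4 - 4 * s.esymm 1 ^ 2 * s.esymm 2
      + 2 * s.esymm 2 ^ 2 + 4 * s.esymm 1 * s.esymm 3 - 4 * s.esymm 4 := by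
  induction s using Multiset.induction_on with
  | empty => simp [esymm_nil_succ 0, esymm_nil_succ 1, esymm_nil_succ 2, esymm_nil_succ 3]
  | cons a s ih =>
    obtain ⟨h1, h2, h3, h4⟩ := ih
    have e1 := esymm_cons_succ a s 0
    have e2 := esymm_cons_succ a s 1
    have e3 := esymm_cons_succ a s 2
    have e4 := esymm_cons_succ a s 3
    norm_num [esymm_zero'] at e1 e2 e3 e4
    simp only [Multiset.map_cons, Multiset.sum_cons, h1, h2, h3, h4, e1, e2, e3, e4]
    refine ⟨?_, ?_, ?_, ?_⟩ <;> ring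

lemma esymm_zeros_add (m : ℕ) (t : Multiset ℂ) (k : ℕ) :
    (Multiset.replicate m 0 + t).esymm k = t.esymm k := by
  induction m with
  | zero => simp
  | succ m ih =>
    cases k with
    | zero => simp [esymm_zero']
    | succ k => rw [Multiset.replicate_succ, Multiset.cons_add, esymm_cons_succ, ih]; simp

lemma coeff_ne_of_halfplane (u : ℂ) (k : ℕ) : ∀ (P : ℂ[X]), P ≠ 0 →
    (∀ z, P.eval z = 0 → 0 < (u * z).re) → k ≤ P.natDegree → P.coeff k ≠ 0 := by
  induction k with
  | zero =>
    intro P _ hr _ h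
    rw [coeff_zero_eq_eval_zero] at h
    have := hr 0 h
    simp at this
  | succ k ih =>
    intro P hP hr hk h
    have hdeg : 0 < P.degree := natDegree_pos_iff_degree_pos.mp (by omega)
    have hnd : (derivative P).natDegree = P.natDegree - 1 := natDegree_derivative P
    have hP' : derivative P ≠ 0 := by
      intro h0
      have := derivative_eq_zero.mp h0
      omega
    refine ih (derivative P) hP' ?_ (by omega) ?_
    · intro z hz
      have hmem : z ∈ (derivative P).rootSet ℂ := by
        rw [mem_rootSet]; exact ⟨hP', by simpa using hz⟩
      have := rootSet_derivative_subset_convexHull_rootSet hdeg hmem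
      have hsub : convexHull ℝ (P.rootSet ℂ) ⊆ {z : ℂ | 0 < (u * z).re} := by
        apply convexHull_min
        · intro w hw
          rw [mem_rootSet] at hw
          exact hr w (by simpa using hw.2)
        · have : IsLinearMap ℝ (fun z : ℂ => (u * z).re) :=
            ⟨fun x y => by simp [mul_add], fun c x => by simp; ring⟩
          exact convex_halfSpace_gt this 0
      exact hsub this
    · rw [coeff_derivative, h, zero_mul]

lemma esymm_ne_of_halfplane (u : ℂ) (t : Multiset ℂ) (ht : ∀ z ∈ t, 0 < (u * z).re) (k : ℕ)
    (hk : k ≤ t.card) : t.esymm k ≠ 0 := by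
  intro h
  have hmon : (t.map (fun z => X - C z)).prod.Monic := monic_multiset_prod_of_monic _ _ (fun z _ => monic_X_sub_C z)
  have := coeff_ne_of_halfplane u (t.card - k) (t.map (fun z => X - C z)).prod hmon.ne_zero ?_ ?_
  · apply this
    rw [Multiset.prod_X_sub_C_coeff _ (by omega)]
    rw [show t.card - (t.card - k) = k by omega, h, mul_zero]
  · intro z hz
    apply ht
    have : z ∈ (t.map (fun z => X - C z)).prod.roots := by
      rw [mem_roots hmon.ne_zero]; exact hz
    rwa [roots_multiset_prod_X_sub_C] at this
  · rw [natDegree_multiset_prod_X_sub_C_eq_card]; omega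

lemma exposed (s : Multiset ℂ) (x u : ℂ) (h : ∀ z ∈ s, z ≠ x → 0 < (u * (z - x)).re) (k : ℕ)
    (hk : k + s.count x ≤ s.card) : (s.map (fun z => z - x)).esymm k ≠ 0 := by
  have h1 : s = Multiset.replicate (s.count x) x + s.filter (fun z => z ≠ x) := by
    conv_lhs => rw [← Multiset.filter_add_not (fun z => z = x) s]
    rw [Multiset.filter_eq']
  have hc : s.card = s.count x + (s.filter (fun z => z ≠ x)).card := by
    conv_lhs => rw [h1]
    simp
  rw [h1, Multiset.map_add, Multiset.map_replicate, sub_self, esymm_zeros_add]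
  apply esymm_ne_of_halfplane u
  · intro z hz
    simp only [Multiset.mem_map, Multiset.mem_filter] at hz
    obtain ⟨w, ⟨hw, hne⟩, rfl⟩ := hz
    exact h w hw hne
  · rw [Multiset.card_map]; omega

/-- final reduction -/
lemma reduce (main : ∀ s : Multiset ℂ, CAM s → s.toFinset.card ≤ 4 → ∃ b, ∀ z ∈ s, z = b)
    (f : Polynomial ℂ) (d : ℕ) (hd : 1 ≤ d)
    (hmonic : f.Monic) (hdeg : f.natDegree = d)
    (hCA : ∀ i : ℕ, 1 ≤ i → i ≤ d - 1 →
      ∃ z : ℂ, f.eval z = 0 ∧ (Polynomial.hasseDeriv i f).eval z = 0)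
    (hroots : f.roots.toFinset.card ≤ 4) :
    ∃ b : ℂ, f = (X - C b) ^ d := by
  have hsp : f.Splits := IsAlgClosed.splits f
  have hcard : f.roots.card = d := by rw [← hdeg]; exact hsp.natDegree_eq_card_roots.symm
  have hprod : f = (f.roots.map (fun z => X - C z)).prod := hsp.eq_prod_roots_of_monic hmonic
  have hC : CAM f.roots := by
    intro k hk1 hk2
    obtain ⟨x, hx, hx2⟩ := hCA (d - k) (by omega) (by omega)
    refine ⟨x, (mem_roots hmonic.ne_zero).mpr hx, ?_⟩
    rw [← taylor_coeff] at hx2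
    have ht : taylor x f = ((f.roots.map (fun z => z - x)).map (fun z => X - C z)).prod := by
      conv_lhs => rw [hprod]
      rw [taylor_apply, multiset_prod_comp, Multiset.map_map, Multiset.map_map]
      congr 1
      apply Multiset.map_congr rfl
      intro z _
      simp; ring
    rw [ht, Multiset.prod_X_sub_C_coeff _ (by rw [Multiset.card_map]; omega), Multiset.card_map,
      hcard, show d - (d - k) = k by omega] at hx2
    simpa using hx2
  obtain ⟨b, hb⟩ := main f.roots hC hroots
  · refine ⟨b, ?_⟩
    have : f.roots = Multiset.replicate d b := Multiset.eq_replicate.mpr ⟨hcard, hb⟩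
    rw [this] at hprod
    simpa using hprod

lemma real_k3 (m0 a c e A t : ℝ) (h0 : 1 ≤ m0) (ha : 1 ≤ a) (hc : 1 ≤ c) (he : 1 ≤ e) (hA : 0 < A)
    (ht : 1 < t) (R1 : a * (-A) + c + e * t = 0)
    (q2 : m0 * (-1) ^ 2 + a * (-A - 1) ^ 2 + e * (t - 1) ^ 2
      = (m0 * (-1) + a * (-A - 1) + e * (t - 1)) ^ 2)
    (q3 : m0 * (-1) ^ 3 + a * (-A - 1) ^ 3 + e * (t - 1) ^ 3
      = (m0 * (-1) + a * (-A - 1) + e * (t - 1)) ^ 3) : False := by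
  obtain ⟨n, hn⟩ : ∃ n, n = m0 + a + c + e := ⟨_, rfl⟩
  have q1 : m0 * (-1) + a * (-A - 1) + e * (t - 1) = -n := by rw [hn]; linear_combination R1
  rw [q1] at q2 q3
  have hn0 : 1 ≤ n := by linarith
  have h1 : (A + 1) ^ 2 ≤ n ^ 2 := by nlinarith [sq_nonneg (A + 1), sq_nonneg (t - 1)]
  have h2 : A + 1 ≤ n := by nlinarith
  have h3 : m0 * (n - 1) + a * (A + 1) ^ 2 * (n - (A + 1)) + e * (t - 1) ^ 2 * (t - 1 + n) = 0 := by
    linear_combination q3 + n * q2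
  have h4 : 0 ≤ m0 * (n - 1) := mul_nonneg (by linarith) (by linarith)
  have h5 : 0 ≤ a * (A + 1) ^ 2 * (n - (A + 1)) :=
    mul_nonneg (mul_nonneg (by linarith) (sq_nonneg _)) (by linarith)
  have h6 : 0 < e * (t - 1) ^ 2 * (t - 1 + n) :=
    mul_pos (mul_pos (by linarith) (pow_pos (by linarith) 2)) (by linarith)
  linarith

lemma real_R3 (a c e A t : ℝ) (ha : 1 ≤ a) (hc : 1 ≤ c) (he : 1 ≤ e) (hA : 0 < A)
    (ht : 1 < t) (R1 : a * A = c + e * t) (R3 : a * A ^ 3 = c + e * t ^ 3) :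
    e < a ∧ a < c + e := by
  constructor
  · by_contra! h
    have h1 : t < A := by
      by_contra! h1
      have : a * A ≤ e * t := mul_le_mul h h1 hA.le (by linarith)
      linarith
    have h2 : a * A ^ 3 = A ^ 2 * c + A ^ 2 * (e * t) := by linear_combination A ^ 2 * R1
    have h3 : 1 < A ^ 2 := by nlinarith
    have h4 : t ^ 2 < A ^ 2 := by nlinarith
    have h5 : t ^ 2 * (e * t) < A ^ 2 * (e * t) := mul_lt_mul_of_pos_right h4 (by positivity)
    have h6 : 1 * c < A ^ 2 * c := mul_lt_mul_of_pos_right h3 (by linarith)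
    nlinarith
  · by_contra! h
    have h1 : (c + e * t) ^ 3 = a ^ 2 * (c + e * t ^ 3) := by
      rw [← R1, ← R3]; ring
    have h2 : (c + e) ^ 2 ≤ a ^ 2 := by
      apply pow_le_pow_left₀ (by linarith) h
    have h3 : (c + e) ^ 2 * (c + e * t ^ 3) ≤ a ^ 2 * (c + e * t ^ 3) :=
      mul_le_mul_of_nonneg_right h2 (by positivity)
    have h4 : (c + e) ^ 2 * (c + e * t ^ 3) - (c + e * t) ^ 3
        = c * e * ((t - 1) ^ 2 * ((c + 2 * e) * t + (e + 2 * c))) := by ring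
    have h5 : 0 < c * e * ((t - 1) ^ 2 * ((c + 2 * e) * t + (e + 2 * c))) := by
      have : 0 < t - 1 := by linarith
      positivity
    linarith

lemma real_k4a (a c e A t : ℝ) (ha : 2 ≤ a) (hc : 1 ≤ c) (he : 1 ≤ e) (hA : 0 < A)
    (ht : 1 < t) (R1 : a * (-A) + c + e * t = 0) (R3 : a * (-A) ^ 3 + c + e * t ^ 3 = 0)
    (R4 : 2 * (a * (-A) ^ 4 + c + e * t ^ 4) = (a * (-A) ^ 2 + c + e * t ^ 2) ^ 2) : False := by
  have h1 : a * (-A) ^ 4 + c + e * t ^ 4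
      = (A * t + A - t) * (a * (-A) ^ 2 + c + e * t ^ 2) := by
    linear_combination (1 + t - A) * R3 + (-A * t) * R1
  have h2 : 0 < a * (-A) ^ 2 + c + e * t ^ 2 := by positivity
  have h3 : 2 * (A * t + A - t) = a * (-A) ^ 2 + c + e * t ^ 2 := by
    apply mul_right_cancel₀ h2.ne'
    linear_combination R4 - 2 * h1
  nlinarith [sq_nonneg (A - t), sq_nonneg (A - 1), sq_nonneg A, sq_nonneg t]

lemma real_k4b (m0 a c e A t : ℝ) (h0 : 1 ≤ m0) (ha : 2 ≤ a) (hc : 1 ≤ c) (he : 1 ≤ e)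
    (hn : 6 ≤ m0 + a + c + e)
    (R1 : a * (-A) + c + e * t = 0) (R3 : a * (-A) ^ 3 + c + e * t ^ 3 = 0)
    (q2 : m0 * (-1) ^ 2 + a * (-A - 1) ^ 2 + e * (t - 1) ^ 2
      = (m0 * (-1) + a * (-A - 1) + e * (t - 1)) ^ 2)
    (q4 : 3 * (m0 * (-1) ^ 4 + a * (-A - 1) ^ 4 + e * (t - 1) ^ 4)
      = 3 * (m0 * (-1) + a * (-A - 1) + e * (t - 1)) ^ 4
        + 4 * (m0 * (-1) + a * (-A - 1) + e * (t - 1))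
          * (m0 * (-1) ^ 3 + a * (-A - 1) ^ 3 + e * (t - 1) ^ 3
            - (m0 * (-1) + a * (-A - 1) + e * (t - 1)) ^ 3)) : False := by
  obtain ⟨n, hn'⟩ : ∃ n, n = m0 + a + c + e := ⟨_, rfl⟩
  have q1 : m0 * (-1) + a * (-A - 1) + e * (t - 1) = -n := by rw [hn']; linear_combination R1
  rw [q1] at q2 q4
  rw [← hn'] at hn
  obtain ⟨R2, hR2⟩ : ∃ R2, R2 = a * (-A) ^ 2 + c + e * t ^ 2 := ⟨_, rfl⟩
  obtain ⟨R4, hR4⟩ : ∃ R4, R4 = a * (-A) ^ 4 + c + e * t ^ 4 := ⟨_, rfl⟩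
  have e2 : R2 = n ^ 2 - n := by
    linear_combination hR2 + q2 + 2 * R1 + hn'
  have e3 : m0 * (-1) ^ 3 + a * (-A - 1) ^ 3 + e * (t - 1) ^ 3 = - 3 * R2 - n := by
    linear_combination R3 + 3 * R1 + 3 * hR2 + hn'
  have e4 : m0 * (-1) ^ 4 + a * (-A - 1) ^ 4 + e * (t - 1) ^ 4 = R4 + 6 * R2 + n := by
    linear_combination -4 * R3 - 4 * R1 - hR4 - 6 * hR2 - hn'
  rw [e3, e4, e2] at q4
  have f4 : 3 * R4 = - (n * (n - 1) * (n ^ 2 - 11 * n + 15)) := by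
    linear_combination q4
  have cs : R2 ^ 2 ≤ (a + c + e) * R4 := by
    have : (a + c + e) * R4 - R2 ^ 2 = a * c * (A ^ 2 - 1) ^ 2 + a * e * (A ^ 2 - t ^ 2) ^ 2
        + c * e * (t ^ 2 - 1) ^ 2 := by rw [hR2, hR4]; ring
    have : 0 ≤ a * c * (A ^ 2 - 1) ^ 2 + a * e * (A ^ 2 - t ^ 2) ^ 2
        + c * e * (t ^ 2 - 1) ^ 2 := by positivity
    linarith
  have hR4p : 0 ≤ R4 := by rw [hR4]; positivity
  have cs2 : R2 ^ 2 ≤ (n - 1) * R4 := by nlinarith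
  have h7 : 0 < n * (n - 1) ^ 2 := by
    have : 0 < n - 1 := by linarith
    have : 0 < n := by linarith
    positivity
  have h8 : (n * (n - 1) ^ 2) * (n ^ 2 - 8 * n + 15) ≤ 0 := by
    rw [e2] at cs2
    nlinarith
  have h9 : 0 < n ^ 2 - 8 * n + 15 := by nlinarith
  nlinarith [mul_pos h7 h9]

lemma ofReal_cancel {w : ℂ} (hw : w ≠ 0) (j : ℕ) {x y : ℝ} (h : w ^ j * (x : ℂ) = w ^ j * (y : ℂ)) :
    x = y := by
  have := mul_left_cancel₀ (pow_ne_zero j hw) h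
  exact_mod_cast this

lemma re_conj_mul (w : ℂ) (x : ℝ) : ((starRingEnd ℂ w) * ((x : ℂ) * w)).re = x * Complex.normSq w := by
  rw [show (starRingEnd ℂ w) * ((x : ℂ) * w) = (x : ℂ) * (w * starRingEnd ℂ w) by ring,
    Complex.mul_conj]
  norm_cast

lemma caseB (s : Multiset ℂ) (m0 a c e : ℕ) (h0 : 1 ≤ m0) (ha : 1 ≤ a) (hc : 1 ≤ c) (he : 1 ≤ e)
    (w : ℂ) (hw : w ≠ 0) (A t : ℝ) (hA : 0 < A) (ht : 1 < t)
    (hs : s = Multiset.replicate m0 0 + Multiset.replicate a ((-A : ℝ) * w)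
      + Multiset.replicate c w + Multiset.replicate e ((t : ℝ) * w))
    (hCA : CAM s) (h1 : s.esymm 1 = 0) : False := by
  have hwn : 0 < Complex.normSq w := Complex.normSq_pos.mpr hw
  have hcard : s.card = m0 + a + c + e := by rw [hs]; simp
  have hmem : ∀ z ∈ s, z = ((0 : ℝ) : ℂ) * w ∨ z = ((-A : ℝ) : ℂ) * w ∨ z = ((1 : ℝ) : ℂ) * w
      ∨ z = (t : ℂ) * w := by
    intro z hz
    rw [hs] at hz
    simp only [Multiset.mem_add, Multiset.mem_replicate] at hz
    rcases hz with ((hz | hz) | hz) | hz <;> simp [hz.2]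
  have inj : ∀ x y : ℝ, x ≠ y → ((x : ℂ) * w) ≠ (y : ℂ) * w := by
    intro x y hxy h
    exact hxy (by exact_mod_cast mul_right_cancel₀ hw h)
  have hs' : s = Multiset.replicate m0 (((0 : ℝ) : ℂ) * w) + Multiset.replicate a ((-A : ℝ) * w)
      + Multiset.replicate c (((1 : ℝ) : ℂ) * w) + Multiset.replicate e ((t : ℝ) * w) := by
    rw [hs]; simp
  have cA : s.count (((-A : ℝ) : ℂ) * w) = a := by
    rw [hs']
    simp only [Multiset.count_add, Multiset.count_replicate]
    rw [if_neg (inj _ _ (by linarith)), if_pos trivial, if_neg (inj _ _ (by linarith)),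
      if_neg (inj _ _ (by linarith))]
    simp
  have ct : s.count ((t : ℂ) * w) = e := by
    rw [hs']
    simp only [Multiset.count_add, Multiset.count_replicate]
    rw [if_neg (inj _ _ (by linarith)), if_pos trivial, if_neg (inj _ _ (by linarith)),
      if_neg (inj _ _ (by linarith))]
    simp
  have exA : ∀ k, k + a ≤ s.card → (s.map (fun z => z - ((-A : ℝ) : ℂ) * w)).esymm k ≠ 0 := by
    intro k hk
    apply exposed s _ (starRingEnd ℂ w) _ k (by rw [cA]; exact hk)
    intro z hz hne
    rcases hmem z hz with rfl | rfl | rfl | rfl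
    · rw [← sub_mul, ← Complex.ofReal_sub, re_conj_mul]; exact mul_pos (by linarith) hwn
    · exact absurd rfl hne
    · rw [← sub_mul, ← Complex.ofReal_sub, re_conj_mul]; exact mul_pos (by linarith) hwn
    · rw [← sub_mul, ← Complex.ofReal_sub, re_conj_mul]; exact mul_pos (by linarith) hwn
  have ext : ∀ k, k + e ≤ s.card → (s.map (fun z => z - (t : ℂ) * w)).esymm k ≠ 0 := by
    intro k hk
    apply exposed s _ (-(starRingEnd ℂ w)) _ k (by rw [ct]; exact hk)
    intro z hz hne
    rcases hmem z hz with rfl | rfl | rfl | rfl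
    · rw [← sub_mul, ← Complex.ofReal_sub, neg_mul, Complex.neg_re, re_conj_mul]; nlinarith
    · rw [← sub_mul, ← Complex.ofReal_sub, neg_mul, Complex.neg_re, re_conj_mul]; nlinarith
    · rw [← sub_mul, ← Complex.ofReal_sub, neg_mul, Complex.neg_re, re_conj_mul]; nlinarith
    · exact absurd rfl hne
  have key : ∀ k, 1 ≤ k → k + a ≤ s.card → k + e ≤ s.card →
      s.esymm k = 0 ∨ (s.map (fun z => z - w)).esymm k = 0 := by
    intro k hk1 hka hke
    obtain ⟨x, hx, hx0⟩ := hCA k hk1 (by omega)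
    rcases hmem x hx with rfl | rfl | rfl | rfl
    · left; simpa using hx0
    · exact absurd hx0 (exA k hka)
    · right; simpa using hx0
    · exact absurd hx0 (ext k hke)
  -- power sums
  have P : ∀ j, 1 ≤ j → (s.map (fun z => z ^ j)).sum
      = w ^ j * ((a * (-A) ^ j + c + e * t ^ j : ℝ) : ℂ) := by
    intro j hj
    rw [hs]
    simp [mul_pow, show j ≠ 0 by omega]
    ring
  have Q : ∀ j, ((s.map (fun z => z - w)).map (fun z => z ^ j)).sum
      = w ^ j * ((m0 * (-1) ^ j + a * (-A - 1) ^ j + c * 0 ^ j + e * (t - 1) ^ j : ℝ) : ℂ) := by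
    intro j
    have e1 : (0 : ℂ) - w = (-1) * w := by ring
    have e2 : ((-A : ℝ) : ℂ) * w - w = (-A - 1) * w := by push_cast; ring
    have e3 : w - w = 0 * w := by ring
    have e4 : (t : ℂ) * w - w = (t - 1) * w := by ring
    rw [hs]
    simp only [Multiset.map_add, Multiset.map_replicate, Multiset.sum_add, Multiset.sum_replicate,
      e1, e2, e3, e4, mul_pow, nsmul_eq_mul]
    push_cast
    ring
  obtain ⟨n1, n2, n3, n4⟩ := newton_ids s
  obtain ⟨v1, v2, v3, v4⟩ := newton_ids (s.map (fun z => z - w))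
  have P1 := P 1 le_rfl
  have Q1 := Q 1
  simp only [pow_one] at P1 Q1
  rw [n1] at P1
  rw [v1] at Q1
  rw [P 2 (by norm_num)] at n2
  rw [P 3 (by norm_num)] at n3
  rw [P 4 (by norm_num)] at n4
  rw [Q 2] at v2
  rw [Q 3] at v3
  rw [Q 4] at v4
  rw [h1] at P1 n2 n3 n4
  rw [Q1] at v2 v3 v4
  have h0' : (1 : ℝ) ≤ m0 := by exact_mod_cast h0
  have ha' : (1 : ℝ) ≤ a := by exact_mod_cast ha
  have hc' : (1 : ℝ) ≤ c := by exact_mod_cast hc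
  have he' : (1 : ℝ) ≤ e := by exact_mod_cast he
  have R1 : (a * (-A) + c + e * t : ℝ) = 0 := by
    apply ofReal_cancel hw 1
    rw [pow_one, ← P1]; simp
  -- k = 2
  have E2 : (s.map (fun z => z - w)).esymm 2 = 0 := by
    rcases key 2 (by norm_num) (by omega) (by omega) with h | h
    · exfalso
      have : (a * (-A) ^ 2 + c + e * t ^ 2 : ℝ) = 0 := by
        apply ofReal_cancel hw 2
        rw [n2, h]; simp
      have : (0 : ℝ) < a * (-A) ^ 2 + c + e * t ^ 2 := by positivity
      linarith
    · exact h
  rw [E2] at v2 v3 v4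
  have q2 : (m0 * (-1) ^ 2 + a * (-A - 1) ^ 2 + e * (t - 1) ^ 2 : ℝ)
      = (m0 * (-1) + a * (-A - 1) + e * (t - 1)) ^ 2 := by
    apply ofReal_cancel hw 2
    push_cast at v2 ⊢
    linear_combination v2
  -- k = 3
  have E3 : s.esymm 3 = 0 := by
    rcases key 3 (by norm_num) (by omega) (by omega) with h | h
    · exact h
    · exfalso
      refine real_k3 m0 a c e A t h0' ha' hc' he' hA ht R1 q2 ?_
      apply ofReal_cancel hw 3
      rw [h] at v3
      push_cast at v3 ⊢
      linear_combination v3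
  rw [E3] at n3 n4
  have R3 : (a * (-A) ^ 3 + c + e * t ^ 3 : ℝ) = 0 := by
    apply ofReal_cancel hw 3
    rw [n3]; simp
  obtain ⟨i1, i2⟩ := real_R3 a c e A t ha' hc' he' hA ht (by linarith) (by linarith)
  have i1' : e < a := by exact_mod_cast i1
  have i2' : a < c + e := by exact_mod_cast i2
  have ha2 : (2 : ℝ) ≤ a := by exact_mod_cast (by omega : 2 ≤ a)
  have hn6 : (6 : ℝ) ≤ m0 + a + c + e := by exact_mod_cast (by omega : 6 ≤ m0 + a + c + e)
  rcases key 4 (by norm_num) (by omega) (by omega) with h | h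
  · rw [h] at n4
    refine real_k4a a c e A t ha2 hc' he' hA ht R1 R3 ?_
    apply ofReal_cancel hw 4
    push_cast at n2 n4 ⊢
    linear_combination 2 * n4 - (w ^ 2 * (a * (-A) ^ 2 + c + e * t ^ 2) - 2 * s.esymm 2) * n2
  · rw [h] at v4
    refine real_k4b m0 a c e A t h0' ha2 hc' he' hn6 R1 R3 q2 ?_
    apply ofReal_cancel hw 4
    push_cast at v3 v4 ⊢
    linear_combination 3 * v4 - 4 * w * (m0 * (-1) + a * (-A - 1) + e * (t - 1)) * v3

lemma caseB' (s : Multiset ℂ) (m0 a c e : ℕ) (h0 : 1 ≤ m0) (ha : 1 ≤ a) (hc : 1 ≤ c) (he : 1 ≤ e)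
    (w : ℂ) (hw : w ≠ 0) (x y z : ℝ) (hxy : x * y < 0) (hyz : y * y < y * z)
    (hs : s = Multiset.replicate m0 0 + Multiset.replicate a ((x : ℂ) * w)
      + Multiset.replicate c ((y : ℂ) * w) + Multiset.replicate e ((z : ℂ) * w))
    (hCA : CAM s) (h1 : s.esymm 1 = 0) : False := by
  have hy : y ≠ 0 := by rintro rfl; simp at hxy
  have hyc : (y : ℂ) ≠ 0 := by exact_mod_cast hy
  have hy2 : 0 < y * y := mul_self_pos.mpr hy
  refine caseB s m0 a c e h0 ha hc he ((y : ℂ) * w) (mul_ne_zero hyc hw) (-x / y) (z / y) ?_ ?_ ?_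
    hCA h1
  · rw [show -x / y = -(x * y) / (y * y) by field_simp]
    exact div_pos (by linarith) hy2
  · rw [show z / y = (y * z) / (y * y) by field_simp, lt_div_iff₀ hy2]
    linarith
  · rw [hs]
    have e1 : ((-(-x / y) : ℝ) : ℂ) * ((y : ℂ) * w) = (x : ℂ) * w := by push_cast; field_simp
    have e2 : ((z / y : ℝ) : ℂ) * ((y : ℂ) * w) = (z : ℂ) * w := by push_cast; field_simp
    rw [e1, e2]

lemma parallel {z w : ℂ} (hw : w ≠ 0) (h : z.re * w.im = z.im * w.re) : ∃ t : ℝ, z = (t : ℂ) * w := by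
  have hwn : 0 < Complex.normSq w := Complex.normSq_pos.mpr hw
  have hn : w.re * w.re + w.im * w.im ≠ 0 := by
    rw [Complex.normSq_apply] at hwn; exact hwn.ne'
  refine ⟨(z.re * w.re + z.im * w.im) / (w.re * w.re + w.im * w.im), ?_⟩
  apply Complex.ext
  · rw [Complex.re_ofReal_mul, div_mul_eq_mul_div, eq_div_iff hn]
    linear_combination w.im * h
  · rw [Complex.im_ofReal_mul, div_mul_eq_mul_div, eq_div_iff hn]
    linear_combination -w.re * h

lemma expo3 (s : Multiset ℂ) (m0 m1 m2 m3 : ℕ) (h1 : 1 ≤ m1) (h2 : 1 ≤ m2)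
    (z1 z2 z3 : ℂ) (n1 : z1 ≠ 0) (n12 : z1 ≠ z2) (n13 : z1 ≠ z3)
    (hs : s = Multiset.replicate m0 0 + Multiset.replicate m1 z1
      + Multiset.replicate m2 z2 + Multiset.replicate m3 z3)
    (hre : m1 * z1.re + m2 * z2.re + m3 * z3.re = 0)
    (him : m1 * z1.im + m2 * z2.im + m3 * z3.im = 0)
    (hD : z2.re * z3.im - z2.im * z3.re ≠ 0) (k : ℕ) (hk : k + m1 ≤ s.card) :
    (s.map (fun z => z - z1)).esymm k ≠ 0 := by
  have hcount : s.count z1 = m1 := by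
    rw [hs]
    simp [Multiset.count_replicate, n1.symm, n12.symm, n13.symm]
  obtain ⟨σ, hσ⟩ : ∃ σ, σ = z2.re * z3.im - z2.im * z3.re := ⟨_, rfl⟩
  have hσ2 : 0 < σ ^ 2 := by rw [← hσ] at hD; positivity
  obtain ⟨u, hu⟩ : ∃ u : ℂ, u = ⟨σ * (z3.im - z2.im), σ * (z3.re - z2.re)⟩ := ⟨_, rfl⟩
  have f : ∀ z : ℂ, (u * z).re = σ * ((z3.im - z2.im) * z.re - (z3.re - z2.re) * z.im) := by
    intro z; rw [hu, Complex.mul_re]; ring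
  have f2 : (u * z2).re = σ ^ 2 := by rw [f, hσ]; ring
  have f3 : (u * z3).re = σ ^ 2 := by rw [f, hσ]; ring
  have f1 : m1 * (u * z1).re = -(m2 + m3) * σ ^ 2 := by
    have : m1 * (u * z1).re + m2 * (u * z2).re + m3 * (u * z3).re = 0 := by
      simp only [f]
      linear_combination σ * (z3.im - z2.im) * hre - σ * (z3.re - z2.re) * him
    rw [f2, f3] at this
    linarith
  have h1' : (0 : ℝ) < m1 := by exact_mod_cast h1
  have h2' : (0 : ℝ) < m2 := by exact_mod_cast h2
  have f1' : (u * z1).re < 0 := by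
    by_contra! h
    have : 0 ≤ m1 * (u * z1).re := by positivity
    have : 0 < (m2 + m3) * σ ^ 2 := by positivity
    linarith
  apply exposed s z1 u _ k (by omega)
  intro z hz hne
  rw [mul_sub, Complex.sub_re]
  rw [hs] at hz
  simp only [Multiset.mem_add, Multiset.mem_replicate] at hz
  rcases hz with ((hz | hz) | hz) | hz
  · rw [hz.2, mul_zero, Complex.zero_re]; linarith
  · exact absurd hz.2 hne
  · rw [hz.2, f2]; linarith
  · rw [hz.2, f3]; linarith

lemma case3 (s : Multiset ℂ) (m0 m1 m2 m3 : ℕ) (h0 : 1 ≤ m0) (h1 : 1 ≤ m1) (h2 : 1 ≤ m2)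
    (h3 : 1 ≤ m3)
    (z1 z2 z3 : ℂ) (n1 : z1 ≠ 0) (n2 : z2 ≠ 0) (n3 : z3 ≠ 0)
    (n12 : z1 ≠ z2) (n13 : z1 ≠ z3) (n23 : z2 ≠ z3)
    (hs : s = Multiset.replicate m0 0 + Multiset.replicate m1 z1
      + Multiset.replicate m2 z2 + Multiset.replicate m3 z3)
    (hCA : CAM s) (he1 : s.esymm 1 = 0) : False := by
  have hcard : s.card = m0 + m1 + m2 + m3 := by rw [hs]; simp
  have P : ∀ j, 1 ≤ j → (s.map (fun z => z ^ j)).sum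
      = m1 * z1 ^ j + m2 * z2 ^ j + m3 * z3 ^ j := by
    intro j hj
    rw [hs]
    simp [show j ≠ 0 by omega]
  obtain ⟨v1, v2, v3, _⟩ := newton_ids s
  have P1 := P 1 le_rfl
  simp only [pow_one] at P1
  rw [v1, he1] at P1
  rw [P 2 (by norm_num), he1] at v2
  rw [P 3 (by norm_num), he1] at v3
  have hre : m1 * z1.re + m2 * z2.re + m3 * z3.re = 0 := by
    have := congrArg Complex.re P1
    simp at this; linarith
  have him : m1 * z1.im + m2 * z2.im + m3 * z3.im = 0 := by
    have := congrArg Complex.im P1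
    simp at this; linarith
  have h1' : (0 : ℝ) < m1 := by exact_mod_cast h1
  have h2' : (0 : ℝ) < m2 := by exact_mod_cast h2
  have h3' : (0 : ℝ) < m3 := by exact_mod_cast h3
  have r13 : m1 * (z1.re * z3.im - z1.im * z3.re) = - (m2 * (z2.re * z3.im - z2.im * z3.re)) := by
    linear_combination z3.im * hre - z3.re * him
  have r12 : m1 * (z1.re * z2.im - z1.im * z2.re) = m3 * (z2.re * z3.im - z2.im * z3.re) := by
    linear_combination z2.im * hre - z2.re * him
  by_cases hD : z2.re * z3.im - z2.im * z3.re = 0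
  · obtain ⟨t2, ht2⟩ := parallel n3 (show z2.re * z3.im = z2.im * z3.re by linarith)
    have hD1 : z1.re * z3.im - z1.im * z3.re = 0 := by
      rw [hD] at r13
      have : (m1 : ℝ) * (z1.re * z3.im - z1.im * z3.re) = 0 := by linarith
      exact (mul_eq_zero.mp this).resolve_left h1'.ne'
    obtain ⟨t1, ht1⟩ := parallel n3 (show z1.re * z3.im = z1.im * z3.re by linarith)
    have hsum : m1 * t1 + m2 * t2 + m3 = 0 := by
      have : ((m1 * t1 + m2 * t2 + m3 : ℝ) : ℂ) * z3 = 0 := by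
        rw [ht1, ht2] at P1
        push_cast
        linear_combination -P1
      have := (mul_eq_zero.mp this).resolve_right n3
      exact_mod_cast this
    have t10 : t1 ≠ 0 := by rintro rfl; simp at ht1; exact n1 ht1
    have t20 : t2 ≠ 0 := by rintro rfl; simp at ht2; exact n2 ht2
    have t11 : t1 ≠ 1 := by rintro rfl; simp at ht1; exact n13 ht1
    have t21 : t2 ≠ 1 := by rintro rfl; simp at ht2; exact n23 ht2
    have t12 : t1 ≠ t2 := by rintro rfl; exact n12 (ht1.trans ht2.symm)
    have hs' : s = Multiset.replicate m0 0 + Multiset.replicate m1 ((t1 : ℂ) * z3)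
      + Multiset.replicate m2 ((t2 : ℂ) * z3) + Multiset.replicate m3 (((1 : ℝ) : ℂ) * z3) := by
      rw [← ht1, ← ht2, hs]; simp
    rcases lt_or_gt_of_ne t10 with g1 | g1 <;> rcases lt_or_gt_of_ne t20 with g2 | g2
    · rcases lt_or_gt_of_ne t12 with g | g
      · exact caseB' s m0 m3 m2 m1 h0 h3 h2 h1 z3 n3 1 t2 t1 (by linarith) (by nlinarith)
          (by rw [hs']; abel) hCA he1
      · exact caseB' s m0 m3 m1 m2 h0 h3 h1 h2 z3 n3 1 t1 t2 (by linarith) (by nlinarith)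
          (by rw [hs']; abel) hCA he1
    · rcases lt_or_gt_of_ne t21 with g | g
      · exact caseB' s m0 m1 m2 m3 h0 h1 h2 h3 z3 n3 t1 t2 1 (by nlinarith) (by nlinarith)
          (by rw [hs']) hCA he1
      · exact caseB' s m0 m1 m3 m2 h0 h1 h3 h2 z3 n3 t1 1 t2 (by nlinarith) (by nlinarith)
          (by rw [hs']; abel) hCA he1
    · rcases lt_or_gt_of_ne t11 with g | g
      · exact caseB' s m0 m2 m1 m3 h0 h2 h1 h3 z3 n3 t2 t1 1 (by nlinarith) (by nlinarith)
          (by rw [hs']; abel) hCA he1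
      · exact caseB' s m0 m2 m3 m1 h0 h2 h3 h1 z3 n3 t2 1 t1 (by nlinarith) (by nlinarith)
          (by rw [hs']; abel) hCA he1
    · have := mul_pos h1' g1
      have := mul_pos h2' g2
      linarith
  · have key : ∀ k, 1 ≤ k → k ≤ 3 → s.esymm k = 0 := by
      intro k hk1 hk3
      obtain ⟨x, hx, hx0⟩ := hCA k hk1 (by omega)
      have hx' := hx
      rw [hs] at hx'
      simp only [Multiset.mem_add, Multiset.mem_replicate] at hx'
      rcases hx' with ((hz | hz) | hz) | hz
      · rw [hz.2] at hx0; simpa using hx0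
      · rw [hz.2] at hx0
        exact absurd hx0 (expo3 s m0 m1 m2 m3 h1 h2 z1 z2 z3 n1 n12 n13 hs hre him hD k (by omega))
      · rw [hz.2] at hx0
        refine absurd hx0 (expo3 s m0 m2 m1 m3 h2 h1 z2 z1 z3 n2 n12.symm n23 (by rw [hs]; abel)
          (by linarith) (by linarith) ?_ k (by omega))
        intro h
        rw [h, mul_zero] at r13
        exact hD ((mul_eq_zero.mp (neg_eq_zero.mp r13.symm)).resolve_left h2'.ne')
      · rw [hz.2] at hx0
        refine absurd hx0 (expo3 s m0 m3 m1 m2 h3 h1 z3 z1 z2 n3 n13.symm n23.symm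
          (by rw [hs]; abel) (by linarith) (by linarith) ?_ k (by omega))
        intro h
        rw [h, mul_zero] at r12
        exact hD ((mul_eq_zero.mp r12.symm).resolve_left h3'.ne')
    rw [key 2 (by norm_num) (by norm_num)] at v2 v3
    rw [key 3 (by norm_num) (by norm_num)] at v3
    have : (m1 : ℂ) * (z1 * ((z1 - z2) * (z1 - z3))) = 0 := by
      linear_combination v3 - (z2 + z3) * v2 - z2 * z3 * P1
    have hm : (m1 : ℂ) ≠ 0 := by exact_mod_cast (by omega : m1 ≠ 0)
    exact mul_ne_zero hm (mul_ne_zero n1 (mul_ne_zero (sub_ne_zero.mpr n12) (sub_ne_zero.mpr n13)))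
      this

lemma expo2 (s : Multiset ℂ) (m0 m1 m2 : ℕ) (h1 : 1 ≤ m1) (h2 : 1 ≤ m2)
    (z1 z2 : ℂ) (n1 : z1 ≠ 0) (n12 : z1 ≠ z2)
    (hs : s = Multiset.replicate m0 0 + Multiset.replicate m1 z1 + Multiset.replicate m2 z2)
    (P1 : m1 * z1 + m2 * z2 = 0) (k : ℕ) (hk : k + m1 ≤ s.card) :
    (s.map (fun z => z - z1)).esymm k ≠ 0 := by
  have hcount : s.count z1 = m1 := by
    rw [hs]
    simp [Multiset.count_replicate, n1.symm, n12.symm]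
  have hn : 0 < Complex.normSq z1 := Complex.normSq_pos.mpr n1
  have h1' : (0 : ℝ) < m1 := by exact_mod_cast h1
  have h2' : (0 : ℝ) < m2 := by exact_mod_cast h2
  have f1 : (-(starRingEnd ℂ z1) * z1).re = - Complex.normSq z1 := by
    have := re_conj_mul z1 1
    simp only [Complex.ofReal_one, one_mul] at this
    rw [neg_mul, Complex.neg_re, this]
  have f2 : 0 < (-(starRingEnd ℂ z1) * z2).re := by
    have h : m1 * (-(starRingEnd ℂ z1) * z1).re + m2 * (-(starRingEnd ℂ z1) * z2).re = 0 := by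
      have := congrArg Complex.re (congrArg (fun z => -(starRingEnd ℂ z1) * z) P1)
      simp at this ⊢
      linarith
    rw [f1] at h
    by_contra! hc
    nlinarith [mul_pos h1' hn]
  apply exposed s z1 (-(starRingEnd ℂ z1)) _ k (by omega)
  intro z hz hne
  rw [mul_sub, Complex.sub_re]
  rw [hs] at hz
  simp only [Multiset.mem_add, Multiset.mem_replicate] at hz
  rcases hz with (hz | hz) | hz
  · rw [hz.2, mul_zero, Complex.zero_re]; linarith
  · exact absurd hz.2 hne
  · rw [hz.2]; linarith

lemma case2 (s : Multiset ℂ) (m0 m1 m2 : ℕ) (h0 : 1 ≤ m0) (h1 : 1 ≤ m1) (h2 : 1 ≤ m2)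
    (z1 z2 : ℂ) (n1 : z1 ≠ 0) (n2 : z2 ≠ 0) (n12 : z1 ≠ z2)
    (hs : s = Multiset.replicate m0 0 + Multiset.replicate m1 z1 + Multiset.replicate m2 z2)
    (hCA : CAM s) (he1 : s.esymm 1 = 0) : False := by
  have hcard : s.card = m0 + m1 + m2 := by rw [hs]; simp
  have P : ∀ j, 1 ≤ j → (s.map (fun z => z ^ j)).sum = m1 * z1 ^ j + m2 * z2 ^ j := by
    intro j hj
    rw [hs]
    simp [show j ≠ 0 by omega]
  obtain ⟨v1, v2, _, _⟩ := newton_ids s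
  have P1 := P 1 le_rfl
  simp only [pow_one] at P1
  rw [v1, he1] at P1
  rw [P 2 (by norm_num), he1] at v2
  have key : s.esymm 2 = 0 := by
    obtain ⟨x, hx, hx0⟩ := hCA 2 (by norm_num) (by omega)
    have hx' := hx
    rw [hs] at hx'
    simp only [Multiset.mem_add, Multiset.mem_replicate] at hx'
    rcases hx' with (hz | hz) | hz
    · rw [hz.2] at hx0; simpa using hx0
    · rw [hz.2] at hx0
      exact absurd hx0 (expo2 s m0 m1 m2 h1 h2 z1 z2 n1 n12 hs P1.symm 2 (by omega))
    · rw [hz.2] at hx0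
      exact absurd hx0 (expo2 s m0 m2 m1 h2 h1 z2 z1 n2 n12.symm (by rw [hs]; abel)
        (by linear_combination -P1) 2 (by omega))
  rw [key] at v2
  have : (m1 : ℂ) * (z1 * (z1 - z2)) = 0 := by
    linear_combination v2 + z2 * P1
  have hm : (m1 : ℂ) ≠ 0 := by exact_mod_cast (by omega : m1 ≠ 0)
  exact mul_ne_zero hm (mul_ne_zero n1 (sub_ne_zero.mpr n12)) this

lemma centred (s : Multiset ℂ) (hCA : CAM s) (he1 : s.esymm 1 = 0) (h0 : 0 ∈ s)
    (hc : s.toFinset.card ≤ 4) : ∀ z ∈ s, z = 0 := by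
  have hins : insert 0 (s.toFinset.erase 0) = s.toFinset := Finset.insert_erase (by simpa using h0)
  have hcard : (s.toFinset.erase 0).card ≤ 3 := by
    rw [Finset.card_erase_of_mem (by simpa using h0)]; omega
  have hsum : s = Multiset.replicate (s.count 0) 0
      + ∑ z ∈ s.toFinset.erase 0, Multiset.replicate (s.count z) z := by
    conv_lhs => rw [← Multiset.toFinset_sum_count_nsmul_eq s, ← hins,
      Finset.sum_insert (Finset.notMem_erase 0 _)]
    simp only [Multiset.nsmul_singleton]
  have hpos : ∀ z ∈ s.toFinset.erase 0, 1 ≤ s.count z ∧ z ≠ 0 := by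
    intro z hz
    rw [Finset.mem_erase, Multiset.mem_toFinset] at hz
    exact ⟨Multiset.one_le_count_iff_mem.mpr hz.2, hz.1⟩
  have hp0 : 1 ≤ s.count 0 := Multiset.one_le_count_iff_mem.mpr h0
  obtain ⟨T, hT⟩ : ∃ T, T = s.toFinset.erase 0 := ⟨_, rfl⟩
  rw [← hT] at hcard hsum hpos
  have : T.card = 0 ∨ T.card = 1 ∨ T.card = 2 ∨ T.card = 3 := by omega
  rcases this with h | h | h | h
  · rw [Finset.card_eq_zero] at h
    rw [h] at hsum
    intro z hz
    rw [hsum] at hz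
    simp only [Finset.sum_empty, add_zero] at hz
    exact Multiset.eq_of_mem_replicate hz
  · exfalso
    obtain ⟨z, rfl⟩ := Finset.card_eq_one.mp h
    obtain ⟨hz1, hz0⟩ := hpos z (by simp)
    obtain ⟨v1, _⟩ := newton_ids s
    rw [he1] at v1
    obtain ⟨m, hm⟩ : ∃ m, m = s.count z := ⟨_, rfl⟩
    rw [hsum, Finset.sum_singleton] at v1
    rw [← hm] at v1 hz1
    simp [hz0] at v1
    omega
  · exfalso
    obtain ⟨x, y, hxy, rfl⟩ := Finset.card_eq_two.mp h
    obtain ⟨hx1, hx0⟩ := hpos x (by simp)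
    obtain ⟨hy1, hy0⟩ := hpos y (by simp)
    rw [Finset.sum_pair hxy, ← add_assoc] at hsum
    exact case2 s _ _ _ hp0 hx1 hy1 x y hx0 hy0 hxy hsum hCA he1
  · exfalso
    obtain ⟨x, y, z, hxy, hxz, hyz, rfl⟩ := Finset.card_eq_three.mp h
    obtain ⟨hx1, hx0⟩ := hpos x (by simp)
    obtain ⟨hy1, hy0⟩ := hpos y (by simp)
    obtain ⟨hz1, hz0⟩ := hpos z (by simp)
    rw [Finset.sum_insert (by simp [hxy, hxz]), Finset.sum_pair hyz, ← add_assoc, ← add_assoc] at hsum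
    exact case3 s _ _ _ _ hp0 hx1 hy1 hz1 x y z hx0 hy0 hz0 hxy hxz hyz hsum hCA he1

lemma mainM (s : Multiset ℂ) (hCA : CAM s) (hc : s.toFinset.card ≤ 4) : ∃ b, ∀ z ∈ s, z = b := by
  by_cases h2 : 1 < s.card
  · obtain ⟨b, hb, hb0⟩ := hCA 1 le_rfl h2
    refine ⟨b, ?_⟩
    have := centred (s.map (fun z => z - b)) ?_ hb0 ?_ ?_
    · intro z hz
      exact sub_eq_zero.mp (this (z - b) (Multiset.mem_map_of_mem _ hz))
    · intro k hk1 hk2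
      rw [Multiset.card_map] at hk2
      obtain ⟨x, hx, hx0⟩ := hCA k hk1 hk2
      refine ⟨x - b, Multiset.mem_map_of_mem _ hx, ?_⟩
      rw [Multiset.map_map]
      simpa using hx0
    · rw [Multiset.mem_map]; exact ⟨b, hb, sub_self b⟩
    · rw [Multiset.toFinset_map]
      exact Finset.card_image_le.trans hc
  · rcases Nat.lt_or_ge 0 s.card with h | h
    · obtain ⟨b, rfl⟩ := Multiset.card_eq_one.mp (by omega : s.card = 1)
      exact ⟨b, by simp⟩
    · have : s = 0 := Multiset.card_eq_zero.mp (by omega)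
      exact ⟨0, by simp [this]⟩

theorem casasAlvero_of_card_roots_le_four (f : Polynomial ℂ) (d : ℕ) (hd : 1 ≤ d)
    (hmonic : f.Monic) (hdeg : f.natDegree = d)
    (hCA : ∀ i : ℕ, 1 ≤ i → i ≤ d - 1 →
      ∃ z : ℂ, f.eval z = 0 ∧ (Polynomial.hasseDeriv i f).eval z = 0)
    (hroots : f.roots.toFinset.card ≤ 4) :
    ∃ b : ℂ, f = (X - C b) ^ d :=
  reduce mainM f d hd hmonic hdeg hCA hroots
end

section
/- Let f ∈ ℝ[x] be a monic polynomial of degree d all of whose roots are real and nonnegative, suppose 0 is a root of f of multiplicity exactly m with 1 ≤ m < d, and let β be the smallest strictly positive root of f. Then the Hasse derivative H_m(f) does not vanish at 0, and the smallest real root of H_m(f) lies in the open interval (0, β). In particular, the smallest root of H_m(f) is not a root of f. -/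
open Polynomial

lemma aux_step (p : ℝ[X]) (hd : 0 < p.natDegree) (hs : p.Splits)
    (hn : ∀ x < 0, p.eval x ≠ 0) :
    (derivative p).Splits ∧ ∀ x < 0, (derivative p).eval x ≠ 0 := by
  have hp0 : p ≠ 0 := by rintro rfl; simp at hd
  constructor
  · rw [splits_iff_card_roots] at hs ⊢
    have h1 := card_roots_le_derivative p
    have h2 := (derivative p).card_roots'
    have h3 := natDegree_derivative_lt hd.ne'
    omega
  · intro x hx
    rw [hs.eval_derivative_eq_eval_mul_sum (hn x hx)]
    refine mul_ne_zero (hn x hx) (ne_of_lt ?_)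
    have hr : p.roots ≠ 0 := by
      rw [← Multiset.card_pos, ← hs.natDegree_eq_card_roots]; exact hd
    have h := Multiset.sum_lt_sum_of_nonempty (s := p.roots) (f := fun z => 1 / (x - z))
      (g := fun _ => (0:ℝ)) hr (by
        intro z hz
        have hz' : p.eval z = 0 := (mem_roots hp0).1 hz
        have : 0 ≤ z ∨ z < 0 := le_or_gt 0 z
        rcases this with h | h
        · exact one_div_neg.2 (by linarith)
        · exact absurd hz' (hn z h))
    simpa using h

lemma aux_iter (f : ℝ[X]) (hs : f.Splits) (hn : ∀ x < 0, f.eval x ≠ 0) (k : ℕ)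
    (hk : k ≤ f.natDegree) :
    (derivative^[k] f).Splits ∧ ∀ x < 0, (derivative^[k] f).eval x ≠ 0 := by
  induction k with
  | zero => exact ⟨hs, hn⟩
  | succ k ih =>
    obtain ⟨h1, h2⟩ := ih (by omega)
    rw [Function.iterate_succ_apply']
    apply aux_step _ _ h1 h2
    have : (derivative^[k] f).coeff (f.natDegree - k) ≠ 0 := by
      rw [coeff_iterate_derivative, Nat.sub_add_cancel (by omega), nsmul_eq_mul]
      have hf : f ≠ 0 := by rintro rfl; simp at hk
      refine mul_ne_zero ?_ (leadingCoeff_ne_zero.2 hf)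
      have : f.natDegree.descFactorial k ≠ 0 := by
        rw [Ne, Nat.descFactorial_eq_zero_iff_lt]; omega
      exact_mod_cast this
    have := le_natDegree_of_ne_zero this
    omega

lemma aux_rolle (f : ℝ[X]) (m : ℕ) (β : ℝ) (hβ : 0 < β) (hr : f.IsRoot β)
    (h0 : ∀ k < m, f.coeff k = 0) (k : ℕ) (hk : k + 1 ≤ m) :
    ∃ b ∈ Set.Ioo 0 β, (derivative^[k+1] f).eval b = 0 := by
  have key : ∀ j < m, ∀ c, 0 < c → (derivative^[j] f).eval c = 0 →
      ∃ b ∈ Set.Ioo 0 c, (derivative^[j+1] f).eval b = 0 := by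
    intro j hj c hc h
    have hz : (derivative^[j] f).eval 0 = 0 := by
      rw [← coeff_zero_eq_eval_zero, coeff_iterate_derivative, zero_add, h0 j hj, smul_zero]
    obtain ⟨b, hb, hb'⟩ := exists_deriv_eq_zero hc
      (f := fun x => (derivative^[j] f).eval x)
      (derivative^[j] f).continuous.continuousOn (by simp [h, hz])
    refine ⟨b, hb, ?_⟩
    rw [Function.iterate_succ_apply']
    simpa using hb'
  induction k with
  | zero => exact key 0 (by omega) β hβ hr
  | succ k ih =>
    obtain ⟨b, hb, hb'⟩ := ih (by omega)
    obtain ⟨c, hc, hc'⟩ := key (k+1) (by omega) b hb.1 hb'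
    exact ⟨c, ⟨hc.1, hc.2.trans hb.2⟩, hc'⟩


theorem smallest_root_hasseDeriv_in_gap (f : Polynomial ℝ) (d : ℕ)
    (hmonic : f.Monic) (hdeg : f.natDegree = d)
    (hreal : Multiset.card f.roots = d)
    (hnonneg : ∀ x ∈ f.roots, (0 : ℝ) ≤ x)
    (m : ℕ) (hm1 : 1 ≤ m) (hmd : m < d) (hmult : f.rootMultiplicity 0 = m)
    (β : ℝ) (hβpos : 0 < β) (hβroot : f.IsRoot β)
    (hβmin : ∀ x : ℝ, f.IsRoot x → 0 < x → β ≤ x) :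
    (Polynomial.hasseDeriv m f).eval 0 ≠ 0 ∧
    ∃ γ : ℝ,
      ((Polynomial.hasseDeriv m f).IsRoot γ ∧
        ∀ x : ℝ, (Polynomial.hasseDeriv m f).IsRoot x → γ ≤ x) ∧
      γ ∈ Set.Ioo (0 : ℝ) β ∧
      ¬ f.IsRoot γ := by
  have hf0 : f ≠ 0 := hmonic.ne_zero
  rw [rootMultiplicity_eq_natTrailingDegree'] at hmult
  have hcm : f.coeff m ≠ 0 := by
    rw [← hmult]; exact trailingCoeff_nonzero_iff_nonzero.2 hf0
  have hlow : ∀ k < m, f.coeff k = 0 := fun k hk =>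
    coeff_eq_zero_of_lt_natTrailingDegree (hmult ▸ hk)
  have hs : f.Splits := by rw [splits_iff_card_roots, hreal, hdeg]
  have hn : ∀ x < 0, f.eval x ≠ 0 := fun x hx h =>
    absurd (hnonneg x ((mem_roots hf0).2 h)) (not_le.2 hx)
  have hrel : ∀ x, (derivative^[m] f).eval x = (m.factorial : ℝ) * (hasseDeriv m f).eval x := by
    intro x
    rw [← factorial_smul_hasseDeriv]
    simp
  have hfac : (m.factorial : ℝ) ≠ 0 := by exact_mod_cast m.factorial_ne_zero
  have hz : (hasseDeriv m f).eval 0 ≠ 0 := by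
    rw [← coeff_zero_eq_eval_zero, hasseDeriv_coeff]
    simpa using hcm
  have hne : hasseDeriv m f ≠ 0 := by
    intro h; rw [h] at hz; simp at hz
  refine ⟨hz, ?_⟩
  obtain ⟨k, rfl⟩ : ∃ k, m = k + 1 := ⟨m - 1, by omega⟩
  obtain ⟨b, hb, hb'⟩ := aux_rolle f (k+1) β hβpos hβroot hlow k le_rfl
  have hbr : b ∈ (hasseDeriv (k+1) f).roots.toFinset := by
    rw [Multiset.mem_toFinset, mem_roots hne]
    rw [hrel] at hb'
    exact (mul_eq_zero.1 hb').resolve_left hfac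
  obtain ⟨γ, hγ, hmin⟩ := Finset.exists_min_image _ id ⟨b, hbr⟩
  rw [Multiset.mem_toFinset, mem_roots hne] at hγ
  have hγpos : 0 < γ := by
    rcases lt_trichotomy γ 0 with h | h | h
    · refine absurd ?_ ((aux_iter f hs hn (k+1) (by omega)).2 γ h)
      rw [hrel, hγ.eq_zero, mul_zero]
    · subst h; exact absurd hγ hz
    · exact h
  have hγβ : γ < β := lt_of_le_of_lt (hmin b hbr) hb.2
  refine ⟨γ, ⟨hγ, fun x hx => hmin x ?_⟩, ⟨hγpos, hγβ⟩, fun h => ?_⟩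
  · rw [Multiset.mem_toFinset, mem_roots hne]; exact hx
  · exact absurd (hβmin γ h hγpos) (not_le.2 hγβ)
end
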